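/- arXiv:2005.03434 — 14 statements merged into one kernel-verified Lean document; each statement's English description precedes it below -/
import Mathlib

section
/- Let Λ > 0 and let Ω > 0 and r > 0 be smooth real functions on a neighborhood of the segment S = {(u,v*) : u* ≤ u ≤ u₂} satisfying ∂_u∂_v r = −Ω²/(4r) − (∂_u r ∂_v r)/r + Ω²Λr/4, with ∂_u r < 0 and r < 1/√Λ on S. If ∂_v r(u*,v*) ≤ 0, then ∂_v r(u,v*) < 0 for all u ∈ (u*,u₂]. -/
open Set

/-- Partial derivative with respect to the first (ingoing, `u`) variable. -/
noncomputable def pdu (f : ℝ × ℝ → ℝ) (p : ℝ × ℝ) : ℝ := deriv (fun s => f (s, p.2)) p.1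

/-- Partial derivative with respect to the second (outgoing, `v`) variable. -/
noncomputable def pdv (f : ℝ × ℝ → ℝ) (p : ℝ × ℝ) : ℝ := deriv (fun t => f (p.1, t)) p.2

theorem stmt1 (Λ : ℝ) (hΛ : 0 < Λ) (Ω r : ℝ × ℝ → ℝ) (ustar u₂ vstar : ℝ)
    (hu : ustar ≤ u₂)
    (O : Set (ℝ × ℝ)) (hO : IsOpen O) (hSO : Icc ustar u₂ ×ˢ ({vstar} : Set ℝ) ⊆ O)
    (hΩreg : ContDiffOn ℝ (⊤ : ℕ∞) Ω O) (hrreg : ContDiffOn ℝ (⊤ : ℕ∞) r O)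
    (hΩpos : ∀ q ∈ O, 0 < Ω q) (hrpos : ∀ q ∈ O, 0 < r q)
    (hwave : ∀ q ∈ O, pdu (pdv r) q =
      -(Ω q) ^ 2 / (4 * r q) - pdu r q * pdv r q / r q + (Ω q) ^ 2 * Λ * r q / 4)
    (hnu : ∀ u ∈ Icc ustar u₂, pdu r (u, vstar) < 0)
    (hrsmall : ∀ u ∈ Icc ustar u₂, r (u, vstar) < 1 / Real.sqrt Λ)
    (h0 : pdv r (ustar, vstar) ≤ 0) :
    ∀ u ∈ Ioc ustar u₂, pdv r (u, vstar) < 0 := by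
  have hseg : ∀ u ∈ Icc ustar u₂, (u, vstar) ∈ O := fun u hu => hSO ⟨hu, rfl⟩
  have hcd : ∀ q ∈ O, ContDiffAt ℝ (⊤ : ℕ∞) r q := fun q hq => hrreg.contDiffAt (hO.mem_nhds hq)
  have hrd : ∀ q ∈ O, DifferentiableAt ℝ r q := fun q hq => (hcd q hq).differentiableAt (by simp)
  have hcurve : ∀ u v : ℝ, DifferentiableAt ℝ (fun s : ℝ => (s, v)) u := fun u v => by fun_prop
  have hpdv : ∀ q ∈ O, pdv r q = fderiv ℝ r q (0, 1) := by
    intro q hq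
    have h1 : HasDerivAt (fun t : ℝ => (q.1, t)) ((0 : ℝ), (1 : ℝ)) q.2 :=
      (hasDerivAt_const q.2 q.1).prodMk (hasDerivAt_id q.2)
    exact ((hrd q hq).hasFDerivAt.comp_hasDerivAt q.2 h1).deriv
  have hpd : ∀ q ∈ O, DifferentiableAt ℝ (pdv r) q := by
    intro q hq
    have h1 : DifferentiableAt ℝ (fun p => fderiv ℝ r p (0, 1)) q := by
      have h2 : ContDiffAt ℝ 1 (fderiv ℝ r) q :=
        (hcd q hq).fderiv_right (m := 1) (WithTop.coe_le_coe.2 (le_top : (1 + 1 : ℕ∞) ≤ ⊤))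
      exact (h2.differentiableAt (by simp)).clm_apply (differentiableAt_const _)
    refine h1.congr_of_eventuallyEq ?_
    filter_upwards [hO.mem_nhds hq] with p hp using hpdv p hp
  have hder : ∀ u ∈ Icc ustar u₂, HasDerivAt (fun s => r (s, vstar) * pdv r (s, vstar))
      (pdu r (u, vstar) * pdv r (u, vstar) + r (u, vstar) * pdu (pdv r) (u, vstar)) u := by
    intro u hu
    have h1 : DifferentiableAt ℝ (fun s => r (s, vstar)) u :=
      (hrd _ (hseg u hu)).comp u (hcurve u vstar)
    have h2 : DifferentiableAt ℝ (fun s => pdv r (s, vstar)) u :=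
      DifferentiableAt.comp (g := pdv r) u (hpd _ (hseg u hu)) (hcurve u vstar)
    exact h1.hasDerivAt.mul h2.hasDerivAt
  have hanti : StrictAntiOn (fun s => r (s, vstar) * pdv r (s, vstar)) (Icc ustar u₂) := by
    refine strictAntiOn_of_deriv_neg (convex_Icc _ _)
      (fun u hu => (hder u hu).continuousAt.continuousWithinAt) ?_
    intro u hu
    have hu' := interior_subset hu
    rw [(hder u hu').deriv, hwave _ (hseg u hu')]
    have hr := hrpos _ (hseg u hu')
    have hΩ := hΩpos _ (hseg u hu')
    have hs := hrsmall u hu'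
    have hsq : 0 < Real.sqrt Λ := Real.sqrt_pos.2 hΛ
    rw [lt_div_iff₀ hsq] at hs
    have hlt : Λ * r (u, vstar) ^ 2 < 1 := by
      have h3 : (r (u, vstar) * Real.sqrt Λ) ^ 2 < 1 :=
        pow_lt_one₀ (by positivity) hs (by norm_num)
      rw [mul_pow, Real.sq_sqrt hΛ.le] at h3
      linarith
    have heq : pdu r (u, vstar) * pdv r (u, vstar) + r (u, vstar) *
        (-(Ω (u, vstar)) ^ 2 / (4 * r (u, vstar))
          - pdu r (u, vstar) * pdv r (u, vstar) / r (u, vstar)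
          + (Ω (u, vstar)) ^ 2 * Λ * r (u, vstar) / 4)
        = -((Ω (u, vstar)) ^ 2 / 4 * (1 - Λ * r (u, vstar) ^ 2)) := by
      field_simp
      ring
    rw [heq]
    have : 0 < (Ω (u, vstar)) ^ 2 / 4 * (1 - Λ * r (u, vstar) ^ 2) :=
      mul_pos (by positivity) (by linarith)
    linarith
  intro u hu1
  have hlt := hanti (left_mem_Icc.2 hu) (Ioc_subset_Icc_self hu1) hu1.1
  have ha := hrpos _ (hseg ustar (left_mem_Icc.2 hu))
  have hb := hrpos _ (hseg u (Ioc_subset_Icc_self hu1))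
  have hc := mul_nonpos_of_nonneg_of_nonpos ha.le h0
  simp only at hlt
  exact (pos_iff_neg_of_mul_neg (lt_of_lt_of_le hlt hc)).1 hb
end

section
/- Let Ω > 0, r ≥ 0, φ be smooth real functions on the rectangle D = [0,U]×[0,V] in the (u,v)-plane satisfying the Raychaudhuri equation ∂_u(Ω⁻² ∂_u r) = −r Ω⁻² (∂_u φ)² on D. If ∂_u r(0,v) < 0 for all v ∈ [0,V], then ∂_u r(u,v) < 0 for all (u,v) ∈ D. -/
open Set

theorem stmt2 (Ω r φ : ℝ × ℝ → ℝ) (U V : ℝ) (hU : 0 ≤ U) (hV : 0 ≤ V)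
    (O : Set (ℝ × ℝ)) (hO : IsOpen O) (hDO : Icc 0 U ×ˢ Icc 0 V ⊆ O)
    (hΩreg : ContDiffOn ℝ (⊤ : ℕ∞) Ω O) (hrreg : ContDiffOn ℝ (⊤ : ℕ∞) r O)
    (hφreg : ContDiffOn ℝ (⊤ : ℕ∞) φ O)
    (hΩpos : ∀ q ∈ O, 0 < Ω q) (hrnonneg : ∀ q ∈ O, 0 ≤ r q)
    (hray : ∀ p ∈ Icc 0 U ×ˢ Icc 0 V,
      pdu (fun q => ((Ω q) ^ 2)⁻¹ * pdu r q) p = -(r p) * ((Ω p) ^ 2)⁻¹ * (pdu φ p) ^ 2)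
    (hinit : ∀ v ∈ Icc 0 V, pdu r (0, v) < 0) :
    ∀ p ∈ Icc 0 U ×ˢ Icc 0 V, pdu r p < 0 := by
  rintro ⟨u, v⟩ ⟨hu, hv⟩
  simp only at hu hv
  have hι : ContDiff ℝ (⊤ : ℕ∞) (fun s : ℝ => (s, v)) := by fun_prop
  set S : Set ℝ := (fun s : ℝ => (s, v)) ⁻¹' O with hS
  have hSo : IsOpen S := hO.preimage hι.continuous
  have hsub : Icc 0 U ⊆ S := fun s hs => hDO ⟨hs, hv⟩
  have hr1 : ContDiffOn ℝ (⊤ : ℕ∞) (fun s => r (s, v)) S :=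
    hrreg.comp hι.contDiffOn (fun s hs => hs)
  have hΩ1 : ContDiffOn ℝ (⊤ : ℕ∞) (fun s => Ω (s, v)) S :=
    hΩreg.comp hι.contDiffOn (fun s hs => hs)
  have hdr : ContDiffOn ℝ (⊤ : ℕ∞) (deriv (fun s => r (s, v))) S :=
    hr1.deriv_of_isOpen hSo (by rfl)
  have hg : DifferentiableOn ℝ
      (fun s => ((Ω (s, v)) ^ 2)⁻¹ * deriv (fun t => r (t, v)) s) S := by
    refine DifferentiableOn.mul (DifferentiableOn.inv ?_ ?_) (hdr.differentiableOn (by simp))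
    · exact (hΩ1.differentiableOn (by simp)).pow 2
    · intro s hs
      exact (pow_pos (hΩpos _ hs) 2).ne'
  have hanti : AntitoneOn
      (fun s => ((Ω (s, v)) ^ 2)⁻¹ * deriv (fun t => r (t, v)) s) (Icc 0 U) := by
    refine antitoneOn_of_deriv_nonpos (convex_Icc 0 U) (hg.mono hsub).continuousOn
      (hg.mono (interior_subset.trans hsub)) ?_
    intro s hs
    have hs' := interior_subset hs
    have h := hray (s, v) ⟨hs', hv⟩
    have h2 : deriv (fun s => ((Ω (s, v)) ^ 2)⁻¹ * deriv (fun t => r (t, v)) s) s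
        = -(r (s, v)) * ((Ω (s, v)) ^ 2)⁻¹ * (pdu φ (s, v)) ^ 2 := h
    rw [h2, neg_mul, neg_mul, neg_nonpos]
    have := hrnonneg (s, v) (hsub hs')
    positivity
  have hle := hanti (left_mem_Icc.2 hU) hu hu.1
  simp only at hle
  have h0 : deriv (fun t => r (t, v)) 0 < 0 := hinit v hv
  have hp0 : 0 < ((Ω (0, v)) ^ 2)⁻¹ := inv_pos.2 (pow_pos (hΩpos _ (hsub (left_mem_Icc.2 hU))) 2)
  have hpu : 0 < ((Ω (u, v)) ^ 2)⁻¹ := inv_pos.2 (pow_pos (hΩpos _ (hsub hu)) 2)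
  have hneg := hle.trans_lt (mul_neg_of_pos_of_neg hp0 h0)
  show deriv (fun t => r (t, v)) u < 0
  exact (pos_iff_neg_of_mul_neg hneg).1 hpu
end

section
/- Suppose the first-order system holds on the segment {u}×[v₁,v₂] (with 0 ≤ v₁ < v₂) together with the non-trapped region hypotheses there. Then κ̄(u,v₂)/κ̄(u,v₁) ≥ exp( 2(ϖ(u,v₂) − ϖ(u,v₁))/r(u,v₂) ). -/
open Set

/-- `1 - μ = 1 - 2ϖ/r - (Λ/3) r²`. -/
noncomputable def oneMinusMu (Λ : ℝ) (r ϖ : ℝ × ℝ → ℝ) (p : ℝ × ℝ) : ℝ :=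
  1 - 2 * ϖ p / r p - Λ / 3 * (r p) ^ 2

/-- `∂_r (1 - μ) = 2ϖ/r² - (2Λ/3) r`. -/
noncomputable def drOneMinusMu (Λ : ℝ) (r ϖ : ℝ × ℝ → ℝ) (p : ℝ × ℝ) : ℝ :=
  2 * ϖ p / (r p) ^ 2 - 2 * Λ / 3 * r p

/-- The first-order double-null Einstein–scalar field system with cosmological
constant `Λ`, at the point `p`, for the area radius `r`, renormalized Hawking
mass `ϖ`, scalar field derivatives `θ = r ∂_v φ`, `ζ = r ∂_u φ`, and the
quantities `κ`, `κb` (`κ̄`); here `λ := ∂_v r` and `ν := ∂_u r`. -/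
def FirstOrderSystem (Λ : ℝ) (r ϖ θ ζ κ κb : ℝ × ℝ → ℝ) (p : ℝ × ℝ) : Prop :=
  pdu (pdv r) p = pdv r p * pdu r p * drOneMinusMu Λ r ϖ p / oneMinusMu Λ r ϖ p ∧
  pdv (pdu r) p = pdv r p * pdu r p * drOneMinusMu Λ r ϖ p / oneMinusMu Λ r ϖ p ∧
  pdu ϖ p = (ζ p) ^ 2 / (2 * κb p) ∧
  pdv ϖ p = (θ p) ^ 2 / (2 * κ p) ∧
  pdu θ p = -(ζ p * pdv r p) / r p ∧
  pdv ζ p = -(θ p * pdu r p) / r p ∧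
  pdv κb p = κb p * (θ p) ^ 2 / (r p * pdv r p) ∧
  pdu κ p = κ p * (ζ p) ^ 2 / (r p * pdu r p) ∧
  pdu r p = κb p * oneMinusMu Λ r ϖ p ∧
  pdv r p = κ p * oneMinusMu Λ r ϖ p

/-- Non-trapped region hypotheses: `λ > 0`, `ν < 0`, `κ > 0`, `κ̄ < 0`,
`ϖ ≥ 0` and `0 < 1 - μ ≤ 1`. -/
def NonTrappedAt (Λ : ℝ) (r ϖ κ κb : ℝ × ℝ → ℝ) (p : ℝ × ℝ) : Prop :=
  0 < pdv r p ∧ pdu r p < 0 ∧ 0 < κ p ∧ κb p < 0 ∧ 0 ≤ ϖ p ∧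
  0 < oneMinusMu Λ r ϖ p ∧ oneMinusMu Λ r ϖ p ≤ 1

theorem seg_hasDeriv (f : ℝ × ℝ → ℝ) (O : Set (ℝ × ℝ)) (hO : IsOpen O)
    (hf : ContDiffOn ℝ (⊤ : ℕ∞) f O) (u v : ℝ) (h : (u, v) ∈ O) :
    HasDerivAt (fun t => f (u, t)) (pdv f (u, v)) v := by
  have h1 : DifferentiableAt ℝ f (u, v) :=
    (hf.contDiffAt (hO.mem_nhds h)).differentiableAt (by simp)
  have h2 : DifferentiableAt ℝ (fun t : ℝ => f (u, t)) v :=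
    DifferentiableAt.comp (g := f) (f := fun t : ℝ => (u, t)) v h1 (by fun_prop)
  exact h2.hasDerivAt

theorem stmt3 (Λ : ℝ) (hΛ : 0 < Λ) (r ϖ θ ζ κ κb : ℝ × ℝ → ℝ)
    (u v₁ v₂ : ℝ) (hv₁ : 0 ≤ v₁) (hv₁₂ : v₁ < v₂)
    (O : Set (ℝ × ℝ)) (hO : IsOpen O) (hSO : ({u} : Set ℝ) ×ˢ Icc v₁ v₂ ⊆ O)
    (hr : ContDiffOn ℝ (⊤ : ℕ∞) r O) (hϖ : ContDiffOn ℝ (⊤ : ℕ∞) ϖ O)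
    (hθ : ContDiffOn ℝ (⊤ : ℕ∞) θ O) (hζ : ContDiffOn ℝ (⊤ : ℕ∞) ζ O)
    (hκ : ContDiffOn ℝ (⊤ : ℕ∞) κ O) (hκb : ContDiffOn ℝ (⊤ : ℕ∞) κb O)
    (hrpos : ∀ p ∈ ({u} : Set ℝ) ×ˢ Icc v₁ v₂, 0 < r p)
    (hsys : ∀ p ∈ ({u} : Set ℝ) ×ˢ Icc v₁ v₂, FirstOrderSystem Λ r ϖ θ ζ κ κb p)
    (hnt : ∀ p ∈ ({u} : Set ℝ) ×ˢ Icc v₁ v₂, NonTrappedAt Λ r ϖ κ κb p) :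
    κb (u, v₂) / κb (u, v₁) ≥ Real.exp (2 * (ϖ (u, v₂) - ϖ (u, v₁)) / r (u, v₂)) := by
  have mem : ∀ v ∈ Icc v₁ v₂, (u, v) ∈ ({u} : Set ℝ) ×ˢ Icc v₁ v₂ := fun v hv => ⟨rfl, hv⟩
  have dr := fun v hv => seg_hasDeriv r O hO hr u v (hSO (mem v hv))
  have dm := fun v hv => seg_hasDeriv ϖ O hO hϖ u v (hSO (mem v hv))
  have dk := fun v hv => seg_hasDeriv κb O hO hκb u v (hSO (mem v hv))
  have h1m : v₁ ∈ Icc v₁ v₂ := ⟨le_rfl, hv₁₂.le⟩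
  have h2m : v₂ ∈ Icc v₁ v₂ := ⟨hv₁₂.le, le_rfl⟩
  have rmono : MonotoneOn (fun t => r (u, t)) (Icc v₁ v₂) := by
    apply monotoneOn_of_deriv_nonneg (convex_Icc _ _)
    · exact fun v hv => (dr v hv).continuousAt.continuousWithinAt
    · exact fun v hv =>
        (dr v (interior_subset hv)).differentiableAt.differentiableWithinAt
    · intro v hv
      rw [(dr v (interior_subset hv)).deriv]
      exact (hnt _ (mem v (interior_subset hv))).1.le
  have dg : ∀ v ∈ Icc v₁ v₂, HasDerivAt
      (fun t => Real.log (κb (u, t)) - 2 * ϖ (u, t) / r (u, v₂))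
      (pdv κb (u, v) / κb (u, v) - 2 * pdv ϖ (u, v) / r (u, v₂)) v := fun v hv =>
    ((dk v hv).log (hnt _ (mem v hv)).2.2.2.1.ne).sub (((dm v hv).const_mul 2).div_const _)
  have gmono : MonotoneOn (fun t => Real.log (κb (u, t)) - 2 * ϖ (u, t) / r (u, v₂))
      (Icc v₁ v₂) := by
    apply monotoneOn_of_deriv_nonneg (convex_Icc _ _)
    · exact fun v hv => (dg v hv).continuousAt.continuousWithinAt
    · exact fun v hv =>
        (dg v (interior_subset hv)).differentiableAt.differentiableWithinAt
    · intro v hv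
      have hv' := interior_subset hv
      rw [(dg v hv').deriv]
      obtain ⟨hl, -, hk, hkb, -, hm0, hm1⟩ := hnt _ (mem v hv')
      obtain ⟨-, -, -, e1, -, -, e2, -, -, e3⟩ := hsys _ (mem v hv')
      have hrv := hrpos _ (mem v hv')
      have hR : r (u, v) ≤ r (u, v₂) := rmono hv' h2m hv'.2
      have hle : pdv r (u, v) ≤ κ (u, v) := by
        rw [e3]; exact mul_le_of_le_one_right hk.le hm1
      have ha : pdv κb (u, v) / κb (u, v) = θ (u, v) ^ 2 / (r (u, v) * pdv r (u, v)) := by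
        rw [e2]; have := hkb.ne; field_simp
      have hb : 2 * pdv ϖ (u, v) / r (u, v₂) = θ (u, v) ^ 2 / (r (u, v₂) * κ (u, v)) := by
        have := hrv.trans_le hR
        rw [e1]; field_simp
      rw [ha, hb, sub_nonneg]
      have := hrv.trans_le hR
      gcongr
  have key := gmono h1m h2m hv₁₂.le
  have n1 := (hnt _ (mem _ h1m)).2.2.2.1
  have n2 := (hnt _ (mem _ h2m)).2.2.2.1
  have hlog : Real.log (κb (u, v₂) / κb (u, v₁)) =
    Real.log (κb (u, v₂)) - Real.log (κb (u, v₁)) := Real.log_div n2.ne n1.ne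
  rw [ge_iff_le, ← Real.le_log_iff_exp_le (div_pos_of_neg_of_neg n2 n1), hlog, mul_sub, sub_div]
  simp only at key
  linarith
end

section
/- Let Λ > 0 and R > 0 with ΛR² < 1. For all real numbers r and ϖ with 0 < r ≤ R, ϖ ≥ 0, and 1 − 2ϖ/r − (Λ/3)r² > 0, one has (2Λr/3 − 2ϖ/r²)/(1 − 2ϖ/r − (Λ/3)r²) ≤ (2ΛR/3)/(1 − ΛR²). -/
theorem stmt4 (Λ R : ℝ) (hΛ : 0 < Λ) (hR : 0 < R) (hΛR : Λ * R ^ 2 < 1) :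
    ∀ r ϖ : ℝ, 0 < r → r ≤ R → 0 ≤ ϖ → 0 < 1 - 2 * ϖ / r - Λ / 3 * r ^ 2 →
      (2 * Λ * r / 3 - 2 * ϖ / r ^ 2) / (1 - 2 * ϖ / r - Λ / 3 * r ^ 2) ≤
        (2 * Λ * R / 3) / (1 - Λ * R ^ 2) := by
  intro r ϖ hr hrR hϖ hD
  have hsq : Λ * r ^ 2 ≤ Λ * R ^ 2 := by gcongr
  have ha : Λ * r ^ 2 < 1 := lt_of_le_of_lt hsq hΛR
  have h2 : (2 * Λ * r / 3) / (1 - Λ * r ^ 2) ≤ (2 * Λ * R / 3) / (1 - Λ * R ^ 2) := by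
    apply div_le_div₀ (by positivity) (by gcongr) (by linarith) (by linarith)
  refine le_trans ?_ h2
  rw [div_le_div_iff₀ hD (by linarith)]
  obtain ⟨x, hx⟩ : ∃ x, x = 2 * ϖ / r := ⟨_, rfl⟩
  have hx0 : 0 ≤ x := by rw [hx]; positivity
  have e : 2 * ϖ / r ^ 2 = x / r := by rw [hx]; field_simp
  rw [e, ← hx]
  rw [← hx] at hD
  obtain ⟨a, hae⟩ : ∃ a, a = Λ * r ^ 2 := ⟨_, rfl⟩
  have hΛe : Λ = a / r ^ 2 := by rw [hae]; field_simp
  have hD' : 0 < 1 - x - a / 3 := by rw [hae]; linarith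
  rw [← hae] at ha
  have key : (2 * a / 3 - x) * (1 - a) ≤ (2 * a / 3) * (1 - x - a / 3) := by
    have h3 : 0 < 1 - a / 3 := by linarith
    have h4 : 0 ≤ (1 - a / 3) * ((2 * a / 3) * (1 - x - a / 3) - (2 * a / 3 - x) * (1 - a)) := by
      have : (1 - a / 3) * ((2 * a / 3) * (1 - x - a / 3) - (2 * a / 3 - x) * (1 - a))
        = (1 - x - a / 3) * (4 * a ^ 2 / 9) + x * (1 - a) ^ 2 := by ring
      rw [this]; positivity
    have := nonneg_of_mul_nonneg_right h4 h3
    linarith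
  have h5 : (2 * Λ * r / 3 - x / r) * (1 - Λ * r ^ 2) = ((2 * a / 3 - x) * (1 - a)) / r := by
    rw [hae]; field_simp
  have h6 : 2 * Λ * r / 3 * (1 - x - Λ / 3 * r ^ 2) = ((2 * a / 3) * (1 - x - a / 3)) / r := by
    rw [hae]; field_simp
  rw [h5, h6]
  gcongr
end

section
/- Let R > 0 with ΛR² < 1 and set α₀ := (2Λ/3)R²/(1−ΛR²). Suppose the first-order system holds on the segment {(s,v) : u₁ ≤ s ≤ u₂} together with the hypotheses λ > 0, ν < 0, ϖ ≥ 0, 0 < 1−μ, and 0 < r ≤ R on this segment. Then λ(u₂,v) ≤ e^{α₀} λ(u₁,v). -/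
open Set

theorem stmt5 (Λ R : ℝ) (hΛ : 0 < Λ) (hR : 0 < R) (hΛR : Λ * R ^ 2 < 1)
    (r ϖ θ ζ κ κb : ℝ × ℝ → ℝ) (u₁ u₂ v : ℝ) (hu : u₁ ≤ u₂)
    (O : Set (ℝ × ℝ)) (hO : IsOpen O) (hSO : Icc u₁ u₂ ×ˢ ({v} : Set ℝ) ⊆ O)
    (hr : ContDiffOn ℝ (⊤ : ℕ∞) r O) (hϖ : ContDiffOn ℝ (⊤ : ℕ∞) ϖ O)
    (hθ : ContDiffOn ℝ (⊤ : ℕ∞) θ O) (hζ : ContDiffOn ℝ (⊤ : ℕ∞) ζ O)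
    (hκ : ContDiffOn ℝ (⊤ : ℕ∞) κ O) (hκb : ContDiffOn ℝ (⊤ : ℕ∞) κb O)
    (hsys : ∀ p ∈ Icc u₁ u₂ ×ˢ ({v} : Set ℝ), FirstOrderSystem Λ r ϖ θ ζ κ κb p)
    (hlam : ∀ p ∈ Icc u₁ u₂ ×ˢ ({v} : Set ℝ), 0 < pdv r p)
    (hnu : ∀ p ∈ Icc u₁ u₂ ×ˢ ({v} : Set ℝ), pdu r p < 0)
    (hϖnn : ∀ p ∈ Icc u₁ u₂ ×ˢ ({v} : Set ℝ), 0 ≤ ϖ p)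
    (hmu : ∀ p ∈ Icc u₁ u₂ ×ˢ ({v} : Set ℝ), 0 < oneMinusMu Λ r ϖ p)
    (hrbd : ∀ p ∈ Icc u₁ u₂ ×ˢ ({v} : Set ℝ), 0 < r p ∧ r p ≤ R) :
    pdv r (u₂, v) ≤ Real.exp (2 * Λ / 3 * R ^ 2 / (1 - Λ * R ^ 2)) * pdv r (u₁, v) := by
  have hmem : ∀ s ∈ Icc u₁ u₂, ((s, v) : ℝ × ℝ) ∈ Icc u₁ u₂ ×ˢ ({v} : Set ℝ) :=
    fun s hs => ⟨hs, rfl⟩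
  have hrd : ∀ p ∈ O, DifferentiableAt ℝ r p := fun p hp =>
    (hr.contDiffAt (hO.mem_nhds hp)).differentiableAt (by simp)
  have hpdv : ∀ p ∈ O, pdv r p = fderiv ℝ r p (0, 1) := by
    intro p hp
    have h1 : HasDerivAt (fun t : ℝ => ((p.1, t) : ℝ × ℝ)) (0, 1) p.2 :=
      (hasDerivAt_const p.2 p.1).prodMk (hasDerivAt_id p.2)
    exact ((hrd p hp).hasFDerivAt.comp_hasDerivAt p.2 h1).deriv
  have hins : ∀ s : ℝ, HasDerivAt (fun t : ℝ => ((t, v) : ℝ × ℝ)) (1, 0) s := fun s =>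
    (hasDerivAt_id s).prodMk (hasDerivAt_const s v)
  have hF : ContDiffOn ℝ 1 (fderiv ℝ r) O := hr.fderiv_of_isOpen hO (by
    norm_cast)
  have hL : ∀ s ∈ Icc u₁ u₂, HasDerivAt (fun t => pdv r (t, v)) (pdu (pdv r) (s, v)) s := by
    intro s hs
    have hp := hSO (hmem s hs)
    have h1 : DifferentiableAt ℝ (fderiv ℝ r) (s, v) :=
      (hF.contDiffAt (hO.mem_nhds hp)).differentiableAt (by simp)
    have h2 : DifferentiableAt ℝ (fun p => fderiv ℝ r p (0, 1)) (s, v) :=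
      h1.clm_apply (differentiableAt_const _)
    have h3 : DifferentiableAt ℝ (pdv r) (s, v) := by
      refine h2.congr_of_eventuallyEq ?_
      filter_upwards [hO.mem_nhds hp] with p hp using hpdv p hp
    exact (h3.comp s (hins s).differentiableAt).hasDerivAt
  have hN : ∀ s ∈ Icc u₁ u₂, HasDerivAt (fun t => r (t, v)) (pdu r (s, v)) s := by
    intro s hs
    have hp := hSO (hmem s hs)
    exact ((hrd _ hp).comp s (hins s).differentiableAt).hasDerivAt
  have hd : 0 < 1 - Λ * R ^ 2 := by linarith
  set C : ℝ := 2 * Λ / 3 * R / (1 - Λ * R ^ 2) with hC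
  have hC0 : 0 < C := by positivity
  have hG : ∀ s ∈ Icc u₁ u₂, HasDerivAt (fun t => pdv r (t, v) * Real.exp (C * r (t, v)))
      (pdu (pdv r) (s, v) * Real.exp (C * r (s, v)) +
        pdv r (s, v) * (Real.exp (C * r (s, v)) * (C * pdu r (s, v)))) s := fun s hs =>
    (hL s hs).mul ((hN s hs).const_mul C).exp
  have hkey : ∀ s ∈ Icc u₁ u₂, pdu (pdv r) (s, v) + pdv r (s, v) * (C * pdu r (s, v)) ≤ 0 := by
    intro s hs
    have hp := hmem s hs
    have hm := hmu _ hp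
    have hw := hϖnn _ hp
    obtain ⟨hr0, hrR⟩ := hrbd _ hp
    have hl := hlam _ hp
    have hn := hnu _ hp
    rw [(hsys _ hp).1]
    have hD : 0 ≤ drOneMinusMu Λ r ϖ (s, v) / oneMinusMu Λ r ϖ (s, v) + C := by
      by_cases h : 0 ≤ drOneMinusMu Λ r ϖ (s, v)
      · positivity
      · push Not at h
        have e : drOneMinusMu Λ r ϖ (s, v) * r (s, v) =
            2 * ϖ (s, v) / r (s, v) - 2 * Λ / 3 * r (s, v) ^ 2 := by
          unfold drOneMinusMu; field_simp
        have h1 : drOneMinusMu Λ r ϖ (s, v) * r (s, v) < 0 := mul_neg_of_neg_of_pos h hr0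
        have h2 : r (s, v) ^ 2 ≤ R ^ 2 := by gcongr
        have h3 : 1 - Λ * R ^ 2 ≤ oneMinusMu Λ r ϖ (s, v) := by
          unfold oneMinusMu; nlinarith
        have h4 : -drOneMinusMu Λ r ϖ (s, v) ≤ 2 * Λ / 3 * R := by
          have : 0 ≤ 2 * ϖ (s, v) / r (s, v) ^ 2 := by positivity
          unfold drOneMinusMu; nlinarith
        have h5 : -drOneMinusMu Λ r ϖ (s, v) / oneMinusMu Λ r ϖ (s, v) ≤ C :=
          div_le_div₀ (by positivity) h4 hd h3
        rw [neg_div] at h5; linarith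
    have := mul_nonneg (mul_pos hl (neg_pos.2 hn)).le hD
    have e2 : pdv r (s, v) * pdu r (s, v) * drOneMinusMu Λ r ϖ (s, v) / oneMinusMu Λ r ϖ (s, v)
      = pdv r (s, v) * pdu r (s, v) * (drOneMinusMu Λ r ϖ (s, v) / oneMinusMu Λ r ϖ (s, v)) := by
      ring
    rw [e2]; nlinarith
  have hanti : AntitoneOn (fun t => pdv r (t, v) * Real.exp (C * r (t, v))) (Icc u₁ u₂) := by
    refine antitoneOn_of_deriv_nonpos (convex_Icc _ _)
      (fun s hs => (hG s hs).continuousAt.continuousWithinAt)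
      (fun s hs => (hG s (interior_subset hs)).differentiableAt.differentiableWithinAt) ?_
    intro s hs
    rw [(hG s (interior_subset hs)).deriv]
    have := mul_nonpos_of_nonneg_of_nonpos (Real.exp_pos (C * r (s, v))).le
      (hkey s (interior_subset hs))
    linarith
  have h1 : u₁ ∈ Icc u₁ u₂ := ⟨le_rfl, hu⟩
  have h2 : u₂ ∈ Icc u₁ u₂ := ⟨hu, le_rfl⟩
  have hfin := hanti h1 h2 hu
  simp only at hfin
  have ha : (1 : ℝ) ≤ Real.exp (C * r (u₂, v)) :=
    Real.one_le_exp (mul_pos hC0 (hrbd _ (hmem _ h2)).1).le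
  have hb : Real.exp (C * r (u₁, v)) ≤ Real.exp (C * R) :=
    Real.exp_le_exp.2 (mul_le_mul_of_nonneg_left (hrbd _ (hmem _ h1)).2 hC0.le)
  have hCR : 2 * Λ / 3 * R ^ 2 / (1 - Λ * R ^ 2) = C * R := by rw [hC]; ring
  rw [hCR]
  have hl1 := hlam _ (hmem _ h1)
  have hl2 := hlam _ (hmem _ h2)
  nlinarith [mul_le_mul_of_nonneg_left ha hl2.le, mul_le_mul_of_nonneg_left hb hl1.le]
end

section
/- Let R > 0 with ΛR² < 1 and set α₀ := (2Λ/3)R²/(1−ΛR²). Suppose the first-order system holds on the rectangle [u₁,u₂]×[v₁,v₂] together with the hypotheses λ > 0, ν < 0, ϖ ≥ 0, 0 < 1−μ, and 0 < r ≤ R there. Then r(u₂,v₂) − r(u₂,v₁) ≤ e^{α₀} ( r(u₁,v₂) − r(u₁,v₁) ). -/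
open Set

lemma aux_pdv_diff {r : ℝ × ℝ → ℝ} {O : Set (ℝ × ℝ)} (hO : IsOpen O)
    (hr : ContDiffOn ℝ (⊤ : ℕ∞) r O) {p : ℝ × ℝ} (hp : p ∈ O) :
    DifferentiableAt ℝ (fun t => r (p.1, t)) p.2 ∧
    DifferentiableAt ℝ (fun s => r (s, p.2)) p.1 ∧
    DifferentiableAt ℝ (fun s => pdv r (s, p.2)) p.1 := by
  have hd : ∀ q ∈ O, DifferentiableAt ℝ r q := fun q hq =>
    ((hr.contDiffAt (hO.mem_nhds hq)).differentiableAt (by simp))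
  have hpd : ∀ q ∈ O, pdv r q = fderiv ℝ r q (0, 1) := by
    intro q hq
    have h1 : HasDerivAt (fun t : ℝ => (q.1, t)) ((0 : ℝ), (1 : ℝ)) q.2 :=
      (hasDerivAt_const q.2 q.1).prodMk (hasDerivAt_id q.2)
    exact (HasFDerivAt.comp_hasDerivAt q.2 (hd q hq).hasFDerivAt h1).deriv
  refine ⟨?_, ?_, ?_⟩
  · exact DifferentiableAt.comp p.2 (f := fun t : ℝ => (p.1, t)) (hd p hp) (by fun_prop)
  · exact DifferentiableAt.comp p.1 (f := fun t : ℝ => (t, p.2)) (hd p hp) (by fun_prop)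
  · have h2 : DifferentiableAt ℝ (fderiv ℝ r) p :=
      ((hr.contDiffAt (hO.mem_nhds hp)).fderiv_right (m := 1)
        (by norm_cast)).differentiableAt (by simp)
    have h3 : DifferentiableAt ℝ (fun q => fderiv ℝ r q (0, 1)) p := by fun_prop
    have h4 : pdv r =ᶠ[nhds p] (fun q => fderiv ℝ r q (0, 1)) :=
      Filter.eventuallyEq_of_mem (hO.mem_nhds hp) hpd
    have h5 : DifferentiableAt ℝ (pdv r) p := h3.congr_of_eventuallyEq h4
    exact DifferentiableAt.comp p.1 (f := fun t : ℝ => (t, p.2)) h5 (by fun_prop)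

lemma aux_alg {Λ R x w : ℝ} (hΛ : 0 < Λ) (hR : 0 < R) (hΛR : Λ * R ^ 2 < 1)
    (hw : 0 ≤ w) (hx : 0 < x) (hxR : x ≤ R) (hm : 0 < 1 - 2 * w / x - Λ / 3 * x ^ 2) :
    0 ≤ (2 * w / x ^ 2 - 2 * Λ / 3 * x) / (1 - 2 * w / x - Λ / 3 * x ^ 2)
      + 2 * Λ / 3 * R / (1 - Λ * R ^ 2) := by
  have hD : 0 < 1 - Λ * R ^ 2 := by linarith
  have hc : 0 ≤ 2 * Λ / 3 * R / (1 - Λ * R ^ 2) := by positivity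
  by_cases hs : 0 ≤ 2 * w / x ^ 2 - 2 * Λ / 3 * x
  · have := div_nonneg hs hm.le
    linarith
  · push Not at hs
    have e : 2 * w / x = (2 * w / x ^ 2) * x := by field_simp
    set y := 2 * w / x ^ 2 with hy
    rw [e] at hm ⊢
    rw [div_add_div _ _ hm.ne' hD.ne']
    apply div_nonneg _ (mul_pos hm hD).le
    by_cases hyy : 0 ≤ y
    · have h0 : Λ * x ^ 2 ≤ Λ * R ^ 2 :=
        mul_le_mul_of_nonneg_left (pow_le_pow_left₀ hx.le hxR 2) hΛ.le
      have h1 : 1 - Λ * R ^ 2 ≤ 1 - y * x - Λ / 3 * x ^ 2 := by nlinarith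
      have h2 : 2 * Λ / 3 * x - y ≤ 2 * Λ / 3 * R := by nlinarith
      have h3 := mul_le_mul h2 h1 hD.le (by positivity)
      nlinarith
    · exact absurd (by rw [hy]; positivity) hyy

theorem stmt6 (Λ R : ℝ) (hΛ : 0 < Λ) (hR : 0 < R) (hΛR : Λ * R ^ 2 < 1)
    (r ϖ θ ζ κ κb : ℝ × ℝ → ℝ) (u₁ u₂ v₁ v₂ : ℝ) (hu : u₁ ≤ u₂) (hv : v₁ ≤ v₂)
    (O : Set (ℝ × ℝ)) (hO : IsOpen O) (hSO : Icc u₁ u₂ ×ˢ Icc v₁ v₂ ⊆ O)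
    (hr : ContDiffOn ℝ (⊤ : ℕ∞) r O) (hϖ : ContDiffOn ℝ (⊤ : ℕ∞) ϖ O)
    (hθ : ContDiffOn ℝ (⊤ : ℕ∞) θ O) (hζ : ContDiffOn ℝ (⊤ : ℕ∞) ζ O)
    (hκ : ContDiffOn ℝ (⊤ : ℕ∞) κ O) (hκb : ContDiffOn ℝ (⊤ : ℕ∞) κb O)
    (hsys : ∀ p ∈ Icc u₁ u₂ ×ˢ Icc v₁ v₂, FirstOrderSystem Λ r ϖ θ ζ κ κb p)
    (hlam : ∀ p ∈ Icc u₁ u₂ ×ˢ Icc v₁ v₂, 0 < pdv r p)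
    (hnu : ∀ p ∈ Icc u₁ u₂ ×ˢ Icc v₁ v₂, pdu r p < 0)
    (hϖnn : ∀ p ∈ Icc u₁ u₂ ×ˢ Icc v₁ v₂, 0 ≤ ϖ p)
    (hmu : ∀ p ∈ Icc u₁ u₂ ×ˢ Icc v₁ v₂, 0 < oneMinusMu Λ r ϖ p)
    (hrbd : ∀ p ∈ Icc u₁ u₂ ×ˢ Icc v₁ v₂, 0 < r p ∧ r p ≤ R) :
    r (u₂, v₂) - r (u₂, v₁) ≤
      Real.exp (2 * Λ / 3 * R ^ 2 / (1 - Λ * R ^ 2)) * (r (u₁, v₂) - r (u₁, v₁)) := by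
  have hD : 0 < 1 - Λ * R ^ 2 := by linarith
  set c : ℝ := 2 * Λ / 3 * R / (1 - Λ * R ^ 2) with hc
  have hc0 : 0 ≤ c := by positivity
  have hα : 2 * Λ / 3 * R ^ 2 / (1 - Λ * R ^ 2) = c * R := by rw [hc]; ring
  rw [hα]
  have key : ∀ v ∈ Icc v₁ v₂, pdv r (u₂, v) ≤ Real.exp (c * R) * pdv r (u₁, v) := by
    intro v hv'
    have hder : ∀ u ∈ Icc u₁ u₂, HasDerivAt
        (fun s => pdv r (s, v) * Real.exp (c * r (s, v)))
        (pdu (pdv r) (u, v) * Real.exp (c * r (u, v)) +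
          pdv r (u, v) * (Real.exp (c * r (u, v)) * (c * pdu r (u, v)))) u := by
      intro u hu'
      obtain ⟨-, h2, h3⟩ := aux_pdv_diff hO hr (hSO (mk_mem_prod hu' hv'))
      exact h3.hasDerivAt.mul ((h2.hasDerivAt.const_mul c).exp)
    have hanti : AntitoneOn (fun s => pdv r (s, v) * Real.exp (c * r (s, v))) (Icc u₁ u₂) := by
      apply antitoneOn_of_deriv_nonpos (convex_Icc _ _)
      · exact fun u hu' => (hder u hu').continuousAt.continuousWithinAt
      · exact fun u hu' => (hder u (interior_subset hu')).differentiableAt.differentiableWithinAt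
      · intro u hu'
        have hu' := interior_subset hu'
        have hp := mk_mem_prod hu' hv'
        rw [(hder u hu').deriv, (hsys _ hp).1]
        have h1 := hlam _ hp
        have h2 := hnu _ hp
        have h3 : 0 ≤ drOneMinusMu Λ r ϖ (u, v) / oneMinusMu Λ r ϖ (u, v) + c :=
          aux_alg hΛ hR hΛR (hϖnn _ hp) (hrbd _ hp).1 (hrbd _ hp).2 (hmu _ hp)
        have h4 := Real.exp_pos (c * r (u, v))
        have : pdv r (u, v) * pdu r (u, v) * drOneMinusMu Λ r ϖ (u, v) / oneMinusMu Λ r ϖ (u, v)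
            * Real.exp (c * r (u, v)) +
            pdv r (u, v) * (Real.exp (c * r (u, v)) * (c * pdu r (u, v)))
          = -(pdv r (u, v) * Real.exp (c * r (u, v)) * (-pdu r (u, v)) *
            (drOneMinusMu Λ r ϖ (u, v) / oneMinusMu Λ r ϖ (u, v) + c)) := by ring
        rw [this]
        have h5 : 0 < -pdu r (u, v) := by linarith
        have := mul_nonneg (mul_pos (mul_pos h1 h4) h5).le h3
        linarith
    have h := hanti (left_mem_Icc.2 hu) (right_mem_Icc.2 hu) hu
    simp only at h
    have hp1 := mk_mem_prod (left_mem_Icc.2 hu) hv'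
    have hp2 := mk_mem_prod (right_mem_Icc.2 hu) hv'
    have e1 : 1 ≤ Real.exp (c * r (u₂, v)) :=
      Real.one_le_exp (mul_nonneg hc0 (hrbd _ hp2).1.le)
    have e2 : Real.exp (c * r (u₁, v)) ≤ Real.exp (c * R) :=
      Real.exp_le_exp.2 (mul_le_mul_of_nonneg_left (hrbd _ hp1).2 hc0)
    have := hlam _ hp1
    have := hlam _ hp2
    nlinarith
  have hder : ∀ v ∈ Icc v₁ v₂, HasDerivAt
      (fun t => Real.exp (c * R) * r (u₁, t) - r (u₂, t))
      (Real.exp (c * R) * pdv r (u₁, v) - pdv r (u₂, v)) v := by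
    intro v hv'
    have h1 := (aux_pdv_diff hO hr (hSO (mk_mem_prod (left_mem_Icc.2 hu) hv'))).1
    have h2 := (aux_pdv_diff hO hr (hSO (mk_mem_prod (right_mem_Icc.2 hu) hv'))).1
    exact (h1.hasDerivAt.const_mul _).sub h2.hasDerivAt
  have hmono : MonotoneOn (fun t => Real.exp (c * R) * r (u₁, t) - r (u₂, t)) (Icc v₁ v₂) := by
    apply monotoneOn_of_deriv_nonneg (convex_Icc _ _)
    · exact fun v hv' => (hder v hv').continuousAt.continuousWithinAt
    · exact fun v hv' => (hder v (interior_subset hv')).differentiableAt.differentiableWithinAt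
    · intro v hv'
      have hv' := interior_subset hv'
      rw [(hder v hv').deriv]
      linarith [key v hv']
  have h := hmono (left_mem_Icc.2 hv) (right_mem_Icc.2 hv) hv
  simp only at h
  linarith
end

section
/- Let R > 0 with ΛR² < 1 and set α₀ := (2Λ/3)R²/(1−ΛR²). Suppose the first-order system holds on the segment {u}×[v₁,v₂] together with the hypotheses λ > 0, ν < 0, ϖ ≥ 0, 0 < 1−μ, and 0 < r ≤ R there. Then −ν(u,v₁) ≤ e^{α₀} (−ν(u,v₂)). -/
open Set

theorem pdu_hasDerivAt_aux (r : ℝ × ℝ → ℝ) (O : Set (ℝ × ℝ)) (hO : IsOpen O)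
    (hr : ContDiffOn ℝ (⊤ : ℕ∞) r O) (u v : ℝ) (hp : (u, v) ∈ O) :
    DifferentiableAt ℝ (fun t => pdu r (u, t)) v ∧ DifferentiableAt ℝ (fun t => r (u, t)) v := by
  have hin : DifferentiableAt ℝ (fun t : ℝ => (u, t)) v := by fun_prop
  have hd : ∀ p ∈ O, DifferentiableAt ℝ r p := fun p h =>
    (hr.contDiffAt (hO.mem_nhds h)).differentiableAt (by simp)
  have heq : ∀ p ∈ O, pdu r p = fderiv ℝ r p (1, 0) := by
    intro p h
    have h1 : HasDerivAt (fun s : ℝ => (s, p.2)) ((1 : ℝ), (0 : ℝ)) p.1 :=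
      (hasDerivAt_id p.1).prodMk (hasDerivAt_const p.1 p.2)
    exact ((hd p h).hasFDerivAt.comp_hasDerivAt p.1 h1).deriv
  have hfd : DifferentiableAt ℝ (fderiv ℝ r) (u, v) :=
    ((hr.contDiffAt (hO.mem_nhds hp)).fderiv_right (m := 1)
      (by norm_cast)).differentiableAt (by simp)
  have hfd2 : DifferentiableAt ℝ (fun p => fderiv ℝ r p (1, 0)) (u, v) :=
    hfd.clm_apply (differentiableAt_const _)
  have hpd : DifferentiableAt ℝ (pdu r) (u, v) := by
    refine hfd2.congr_of_eventuallyEq ?_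
    filter_upwards [hO.mem_nhds hp] with p h using heq p h
  exact ⟨DifferentiableAt.comp v (g := pdu r) hpd hin,
    DifferentiableAt.comp v (g := r) (hd _ hp) hin⟩

theorem ratio_bound_aux (Λ R r w : ℝ) (hΛ : 0 < Λ) (hΛR : Λ * R ^ 2 < 1) (hr : 0 < r)
    (hrR : r ≤ R) (hw : 0 ≤ w) (hm : 0 < 1 - 2 * w / r - Λ / 3 * r ^ 2) :
    0 ≤ (2 * w / r ^ 2 - 2 * Λ / 3 * r) / (1 - 2 * w / r - Λ / 3 * r ^ 2)
      + 2 * Λ / 3 * R / (1 - Λ * R ^ 2) := by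
  have hD : 0 < 1 - Λ * R ^ 2 := by linarith
  have hrr : r ^ 2 ≤ R ^ 2 := by gcongr
  have hΛr : Λ * r ^ 2 ≤ Λ * R ^ 2 := by gcongr
  have e : 2 * w / r ^ 2 = (2 * w / r) / r := by field_simp
  rw [e]
  obtain ⟨x, hx⟩ : ∃ x, x = 2 * w / r := ⟨_, rfl⟩
  have hx0 : 0 ≤ x := by rw [hx]; positivity
  rw [← hx] at hm ⊢
  have h1 : -(2 * Λ / 3 * r / (1 - Λ / 3 * r ^ 2))
      ≤ (x / r - 2 * Λ / 3 * r) / (1 - x - Λ / 3 * r ^ 2) := by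
    have hd : 0 < 1 - Λ / 3 * r ^ 2 := by linarith
    rw [← neg_div, div_le_div_iff₀ hd hm]
    have hk : 0 ≤ x / r * (1 - Λ * r ^ 2) := mul_nonneg (by positivity) (by linarith)
    have hk2 : x / r * (1 - Λ * r ^ 2) = x / r * (1 - Λ / 3 * r ^ 2) - 2 * Λ / 3 * r * x := by
      field_simp
      ring
    linarith
  have h2 : 2 * Λ / 3 * r / (1 - Λ / 3 * r ^ 2) ≤ 2 * Λ / 3 * R / (1 - Λ * R ^ 2) := by
    have : 0 < R := by linarith
    have hy : 0 < Λ * r ^ 2 := by positivity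
    apply div_le_div₀ (by positivity) (by gcongr) hD
    linarith
  linarith

theorem stmt7 (Λ R : ℝ) (hΛ : 0 < Λ) (hR : 0 < R) (hΛR : Λ * R ^ 2 < 1)
    (r ϖ θ ζ κ κb : ℝ × ℝ → ℝ) (u v₁ v₂ : ℝ) (hv : v₁ ≤ v₂)
    (O : Set (ℝ × ℝ)) (hO : IsOpen O) (hSO : ({u} : Set ℝ) ×ˢ Icc v₁ v₂ ⊆ O)
    (hr : ContDiffOn ℝ (⊤ : ℕ∞) r O) (hϖ : ContDiffOn ℝ (⊤ : ℕ∞) ϖ O)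
    (hθ : ContDiffOn ℝ (⊤ : ℕ∞) θ O) (hζ : ContDiffOn ℝ (⊤ : ℕ∞) ζ O)
    (hκ : ContDiffOn ℝ (⊤ : ℕ∞) κ O) (hκb : ContDiffOn ℝ (⊤ : ℕ∞) κb O)
    (hsys : ∀ p ∈ ({u} : Set ℝ) ×ˢ Icc v₁ v₂, FirstOrderSystem Λ r ϖ θ ζ κ κb p)
    (hlam : ∀ p ∈ ({u} : Set ℝ) ×ˢ Icc v₁ v₂, 0 < pdv r p)
    (hnu : ∀ p ∈ ({u} : Set ℝ) ×ˢ Icc v₁ v₂, pdu r p < 0)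
    (hϖnn : ∀ p ∈ ({u} : Set ℝ) ×ˢ Icc v₁ v₂, 0 ≤ ϖ p)
    (hmu : ∀ p ∈ ({u} : Set ℝ) ×ˢ Icc v₁ v₂, 0 < oneMinusMu Λ r ϖ p)
    (hrbd : ∀ p ∈ ({u} : Set ℝ) ×ˢ Icc v₁ v₂, 0 < r p ∧ r p ≤ R) :
    -pdu r (u, v₁) ≤ Real.exp (2 * Λ / 3 * R ^ 2 / (1 - Λ * R ^ 2)) * (-pdu r (u, v₂)) := by
  have hmem : ∀ v ∈ Icc v₁ v₂, (u, v) ∈ ({u} : Set ℝ) ×ˢ Icc v₁ v₂ := fun v h => ⟨rfl, h⟩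
  have hD : 0 < 1 - Λ * R ^ 2 := by linarith
  obtain ⟨C, hC⟩ : ∃ C, C = 2 * Λ / 3 * R / (1 - Λ * R ^ 2) := ⟨_, rfl⟩
  have hC0 : 0 ≤ C := by rw [hC]; positivity
  have hder : ∀ v ∈ Icc v₁ v₂, HasDerivAt
      (fun t => -pdu r (u, t) * Real.exp (C * r (u, t)))
      (-pdv (pdu r) (u, v) * Real.exp (C * r (u, v))
        + -pdu r (u, v) * (Real.exp (C * r (u, v)) * (C * pdv r (u, v)))) v := by
    intro v h
    obtain ⟨h1, h2⟩ := pdu_hasDerivAt_aux r O hO hr u v (hSO (hmem v h))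
    exact h1.hasDerivAt.neg.mul ((h2.hasDerivAt.const_mul C).exp)
  have hmono : MonotoneOn (fun t => -pdu r (u, t) * Real.exp (C * r (u, t))) (Icc v₁ v₂) := by
    refine monotoneOn_of_deriv_nonneg (convex_Icc _ _)
      (fun v h => (hder v h).continuousAt.continuousWithinAt)
      (fun v h => (hder v (interior_subset h)).differentiableAt.differentiableWithinAt) ?_
    intro v h
    have h' := hmem v (interior_subset h)
    rw [(hder v (interior_subset h)).deriv, (hsys _ h').2.1]
    have hb := ratio_bound_aux Λ R (r (u, v)) (ϖ (u, v)) hΛ hΛR (hrbd _ h').1 (hrbd _ h').2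
      (hϖnn _ h') (hmu _ h')
    rw [← hC] at hb
    change 0 ≤ drOneMinusMu Λ r ϖ (u, v) / oneMinusMu Λ r ϖ (u, v) + C at hb
    have hn : 0 ≤ -pdu r (u, v) := by linarith [hnu _ h']
    have := mul_nonneg (mul_nonneg (mul_nonneg hn (hlam _ h').le)
      (Real.exp_pos (C * r (u, v))).le) hb
    refine this.trans_eq ?_
    ring
  have hm := hmono (left_mem_Icc.2 hv) (right_mem_Icc.2 hv) hv
  simp only at hm
  have h1 := hrbd _ (hmem v₁ (left_mem_Icc.2 hv))
  have h2 := hrbd _ (hmem v₂ (right_mem_Icc.2 hv))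
  have hn1 : 0 ≤ -pdu r (u, v₁) := by linarith [hnu _ (hmem v₁ (left_mem_Icc.2 hv))]
  have hn2 : 0 ≤ -pdu r (u, v₂) := by linarith [hnu _ (hmem v₂ (right_mem_Icc.2 hv))]
  have e : 2 * Λ / 3 * R ^ 2 / (1 - Λ * R ^ 2) = C * R := by rw [hC]; ring
  rw [e]
  have a1 : 1 ≤ Real.exp (C * r (u, v₁)) := Real.one_le_exp (mul_nonneg hC0 h1.1.le)
  have a2 : Real.exp (C * r (u, v₂)) ≤ Real.exp (C * R) :=
    Real.exp_le_exp.2 (mul_le_mul_of_nonneg_left h2.2 hC0)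
  nlinarith [mul_le_mul_of_nonneg_left a1 hn1, mul_le_mul_of_nonneg_left a2 hn2]
end

section
/- Let a < 0 and b < 0 be real numbers, let η > 0, and suppose b/a ≥ e^{η}. Then for all real numbers x and y: y²/b − x²/a ≥ (1/b) · (1 + 1/(e^{η} − 1)) · (y − x)². -/
theorem stmt9 (a b η : ℝ) (ha : a < 0) (hb : b < 0) (hη : 0 < η)
    (hba : b / a ≥ Real.exp η) :
    ∀ x y : ℝ,
      y ^ 2 / b - x ^ 2 / a ≥ (1 / b) * (1 + 1 / (Real.exp η - 1)) * (y - x) ^ 2 := by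
  intro x y
  have ht : 1 < Real.exp η := Real.one_lt_exp_iff.mpr hη
  generalize Real.exp η = t at *
  have ht' : 0 < t - 1 := by linarith
  have e1 : y ^ 2 / b - x ^ 2 / a = (y ^ 2 - b / a * x ^ 2) / b := by
    have := ha.ne
    have := hb.ne
    field_simp
  have e2 : (1 / b) * (1 + 1 / (t - 1)) * (y - x) ^ 2
      = ((1 + 1 / (t - 1)) * (y - x) ^ 2) / b := by ring
  have key : (1 + 1 / (t - 1)) * (y - x) ^ 2 - (y ^ 2 - t * x ^ 2)
      = (y - t * x) ^ 2 / (t - 1) := by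
    have := ht'.ne'
    field_simp
    ring
  have h0 : 0 ≤ (y - t * x) ^ 2 / (t - 1) := by positivity
  have h1 : t * x ^ 2 ≤ b / a * x ^ 2 := mul_le_mul_of_nonneg_right hba (sq_nonneg x)
  rw [e1, e2, ge_iff_le]
  exact div_le_div_of_nonpos_of_le hb.le (by linarith)
end

section
/- Let R > 0 with ΛR² < 1 and set α₀ := (2Λ/3)R²/(1−ΛR²). Suppose the first-order system holds on the rectangle [0,U]×[v₁,v₂] (with 0 < v₁ < v₂) together with the non-trapped region hypotheses and 0 < r ≤ R there. Define η(u) := 2(ϖ(u,v₂) − ϖ(u,v₁))/r(u,v₂) and δ(u) := (r(u,v₂) − r(u,v₁))/r(u,v₁). Then for every u ∈ [0,U] with η(u) > 0, the derivative of η satisfies η′(u) ≥ (−ν(u,v₂)/r(u,v₂)) · η(u) · [ 1 − e^{α₀} δ(u) (1 + 1/(e^{η(u)} − 1)) ]. -/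
open Set

theorem aux_mono (f f' : ℝ → ℝ) (a b : ℝ)
    (h : ∀ x ∈ Icc a b, HasDerivAt f (f' x) x) (h0 : ∀ x ∈ Icc a b, 0 ≤ f' x) :
    MonotoneOn f (Icc a b) := by
  apply monotoneOn_of_deriv_nonneg (convex_Icc a b)
  · exact fun x hx => (h x hx).continuousAt.continuousWithinAt
  · intro x hx
    exact (h x (interior_subset hx)).differentiableAt.differentiableWithinAt
  · intro x hx
    rw [(h x (interior_subset hx)).deriv]
    exact h0 x (interior_subset hx)

theorem aux_DM (Λ R r w : ℝ) (hΛ : 0 < Λ) (hR : 0 < R) (hΛR : Λ * R ^ 2 < 1)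
    (hr : 0 < r) (hrR : r ≤ R) (hw : 0 ≤ w)
    (hM : 0 < 1 - 2 * w / r - Λ / 3 * r ^ 2) :
    -(2 * Λ / 3 * R / (1 - Λ * R ^ 2)) ≤
      (2 * w / r ^ 2 - 2 * Λ / 3 * r) / (1 - 2 * w / r - Λ / 3 * r ^ 2) := by
  have hd : 0 < 1 - Λ * R ^ 2 := by linarith
  obtain ⟨m, hm⟩ : ∃ m, m = 2 * w / r := ⟨_, rfl⟩
  have hm0 : 0 ≤ m := by rw [hm]; positivity
  have e : 2 * w / r ^ 2 = m / r := by rw [hm]; field_simp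
  rw [e, ← hm]
  rw [← hm] at hM
  have hc : 0 ≤ 2 * Λ / 3 * R / (1 - Λ * R ^ 2) := by positivity
  rw [le_div_iff₀ hM]
  by_cases h : 2 * Λ / 3 * r ≤ m / r
  · nlinarith [mul_nonneg hc hM.le]
  · push Not at h
    have h2 : m < 2 * Λ / 3 * r * r := by rwa [div_lt_iff₀ hr] at h
    have hr2 : r ^ 2 ≤ R ^ 2 := by gcongr
    have h3 : 1 - Λ * R ^ 2 ≤ 1 - m - Λ / 3 * r ^ 2 := by nlinarith
    have h4 := mul_le_mul_of_nonneg_left h3 hc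
    rw [div_mul_cancel₀ _ hd.ne'] at h4
    have h5 : 0 ≤ m / r := by positivity
    nlinarith

theorem aux_core (Λ R a b : ℝ) (hΛ : 0 < Λ) (hR : 0 < R) (hΛR : Λ * R ^ 2 < 1) (hab : a < b)
    (r w z k n l t q M : ℝ → ℝ)
    (hr' : ∀ x ∈ Icc a b, HasDerivAt r (l x) x)
    (hw' : ∀ x ∈ Icc a b, HasDerivAt w (t x ^ 2 / (2 * q x)) x)
    (hz' : ∀ x ∈ Icc a b, HasDerivAt z (t x * n x / r x) x)
    (hk' : ∀ x ∈ Icc a b, HasDerivAt k (k x * t x ^ 2 / (r x * l x)) x)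
    (hn' : ∀ x ∈ Icc a b, HasDerivAt n
      (l x * n x * (2 * w x / r x ^ 2 - 2 * Λ / 3 * r x) / M x) x)
    (hM : ∀ x ∈ Icc a b, M x = 1 - 2 * w x / r x - Λ / 3 * r x ^ 2)
    (hnk : ∀ x ∈ Icc a b, n x = k x * M x)
    (hlq : ∀ x ∈ Icc a b, l x = q x * M x)
    (hM0 : ∀ x ∈ Icc a b, 0 < M x) (hM1 : ∀ x ∈ Icc a b, M x ≤ 1)
    (hk0 : ∀ x ∈ Icc a b, 0 < k x) (hq0 : ∀ x ∈ Icc a b, 0 < q x)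
    (hw0 : ∀ x ∈ Icc a b, 0 ≤ w x)
    (hr0 : ∀ x ∈ Icc a b, 0 < r x) (hrR : ∀ x ∈ Icc a b, r x ≤ R)
    (η : ℝ) (hη : η = 2 * (w b - w a) / r b) (hη0 : 0 < η) :
    z b ^ 2 / k b - z a ^ 2 / k a ≤
      n b * η * (Real.exp (2 * Λ / 3 * R ^ 2 / (1 - Λ * R ^ 2)) *
            ((r b - r a) / r a) * (1 + 1 / (Real.exp η - 1))) := by
  have ha : a ∈ Icc a b := left_mem_Icc.2 hab.le
  have hb : b ∈ Icc a b := right_mem_Icc.2 hab.le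
  have hl0 : ∀ x ∈ Icc a b, 0 < l x := fun x hx => by
    rw [hlq x hx]; exact mul_pos (hq0 x hx) (hM0 x hx)
  have hn0 : ∀ x ∈ Icc a b, 0 < n x := fun x hx => by
    rw [hnk x hx]; exact mul_pos (hk0 x hx) (hM0 x hx)
  have hrm := aux_mono r l a b hr' (fun x hx => (hl0 x hx).le)
  have hkm := aux_mono k _ a b hk' (fun x hx => by
    have := hk0 x hx; have := hr0 x hx; have := hl0 x hx; positivity)
  have hd : 0 < 1 - Λ * R ^ 2 := by linarith
  have rb := hr0 b hb
  have ra := hr0 a ha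
  have kb := hk0 b hb
  have ka := hk0 a ha
  have nb := hn0 b hb
  -- growth of k
  have h1 : MonotoneOn (fun x => Real.log (k x) - 2 * w x / r b) (Icc a b) := by
    apply aux_mono _ (fun x => k x * t x ^ 2 / (r x * l x) / k x
      - 2 * (t x ^ 2 / (2 * q x)) / r b)
    · intro x hx
      exact ((hk' x hx).log (hk0 x hx).ne').sub (((hw' x hx).const_mul 2).div_const _)
    · intro x hx
      have k0 := hk0 x hx
      have r0 := hr0 x hx
      have q0 := hq0 x hx
      have m0 := hM0 x hx
      have l0 := hl0 x hx
      have e1 : k x * t x ^ 2 / (r x * l x) / k x = t x ^ 2 / (r x * l x) := by field_simp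
      have e2 : 2 * (t x ^ 2 / (2 * q x)) / r b = t x ^ 2 / (r b * q x) := by field_simp
      rw [e1, e2, sub_nonneg]
      have h3 : l x ≤ q x := by
        rw [hlq x hx]; exact mul_le_of_le_one_right q0.le (hM1 x hx)
      have h4 : r x ≤ r b := hrm hx hb hx.2
      gcongr
  have hke : k a * Real.exp η ≤ k b := by
    have h2 := h1 ha hb hab.le
    simp only at h2
    have h3 : Real.log (k a) + η ≤ Real.log (k b) := by
      rw [hη]
      have : 2 * (w b - w a) / r b = 2 * w b / r b - 2 * w a / r b := by ring
      linarith
    have h4 := Real.exp_le_exp.2 h3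
    rwa [Real.exp_add, Real.exp_log ka, Real.exp_log kb] at h4
  -- bound of n
  set c := 2 * Λ / 3 * R / (1 - Λ * R ^ 2) with hc
  have hc0 : 0 ≤ c := by positivity
  have hcR : c * R = 2 * Λ / 3 * R ^ 2 / (1 - Λ * R ^ 2) := by rw [hc]; ring
  rw [← hcR]
  set E := Real.exp (c * R) with hE
  have h2 : MonotoneOn (fun x => Real.log (n x) + c * r x) (Icc a b) := by
    apply aux_mono _ (fun x => l x * n x * (2 * w x / r x ^ 2 - 2 * Λ / 3 * r x) / M x / n x
      + c * l x)
    · intro x hx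
      exact ((hn' x hx).log (hn0 x hx).ne').add ((hr' x hx).const_mul c)
    · intro x hx
      have n0 := hn0 x hx
      have l0 := hl0 x hx
      have m0 := hM0 x hx
      have h3 := aux_DM Λ R (r x) (w x) hΛ hR hΛR (hr0 x hx) (hrR x hx) (hw0 x hx)
        (by rw [← hM x hx]; exact m0)
      rw [← hM x hx, ← hc] at h3
      have e : l x * n x * (2 * w x / r x ^ 2 - 2 * Λ / 3 * r x) / M x / n x
        = l x * ((2 * w x / r x ^ 2 - 2 * Λ / 3 * r x) / M x) := by
        rw [div_div, mul_comm (l x) (n x), mul_comm (M x) (n x), mul_assoc,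
          mul_div_mul_left _ _ n0.ne', mul_div_assoc]
      rw [e]
      nlinarith [mul_le_mul_of_nonneg_left h3 l0.le]
  have hne : ∀ x ∈ Icc a b, n x ≤ n b * E := by
    intro x hx
    have h3 := h2 hx hb hx.2
    simp only at h3
    have h4 : Real.log (n x) ≤ Real.log (n b) + c * R := by
      have : c * r b ≤ c * R := mul_le_mul_of_nonneg_left (hrR b hb) hc0
      have : 0 ≤ c * r x := mul_nonneg hc0 (hr0 x hx).le
      linarith
    have h5 := Real.exp_le_exp.2 h4
    rwa [Real.exp_add, Real.exp_log (hn0 x hx), Real.exp_log nb] at h5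
  -- Cauchy-Schwarz
  set C := k b * (n b * E) with hC
  have hCS : ∀ s : ℝ, 0 ≤ s ^ 2 * (2 * (w b - w a)) - 2 * s * (z b - z a)
      + C * (1 / r a - 1 / r b) := by
    intro s
    have h3 : MonotoneOn (fun x => s ^ 2 * (2 * w x) - 2 * s * z x - C * (r x)⁻¹) (Icc a b) := by
      apply aux_mono _ (fun x => s ^ 2 * (2 * (t x ^ 2 / (2 * q x))) - 2 * s * (t x * n x / r x)
        - C * (-l x / r x ^ 2))
      · intro x hx
        exact ((((hw' x hx).const_mul 2).const_mul (s ^ 2)).sub ((hz' x hx).const_mul (2 * s))).sub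
          (((hr' x hx).inv (hr0 x hx).ne').const_mul C)
      · intro x hx
        have n0 := hn0 x hx
        have l0 := hl0 x hx
        have m0 := hM0 x hx
        have k0 := hk0 x hx
        have r0 := hr0 x hx
        have q0 := hq0 x hx
        have h4 : k x * n x ≤ C := by
          rw [hC]
          exact mul_le_mul (hkm hx hb hx.2) (hne x hx) n0.le kb.le
        have h5 : k x * n x * (l x / r x ^ 2) ≤ C * (l x / r x ^ 2) := by gcongr
        have h6 : k x * n x * (l x / r x ^ 2) = q x * n x ^ 2 / r x ^ 2 := by
          rw [hlq x hx]
          have : n x ^ 2 = n x * (k x * M x) := by rw [← hnk x hx]; ring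
          rw [this]; ring
        have h7 : s ^ 2 * (2 * (t x ^ 2 / (2 * q x))) - 2 * s * (t x * n x / r x)
            + q x * n x ^ 2 / r x ^ 2 = (s * t x - q x * n x / r x) ^ 2 / q x := by
          field_simp
          ring
        have h8 : 0 ≤ (s * t x - q x * n x / r x) ^ 2 / q x := by positivity
        have h9 : C * (-l x / r x ^ 2) = - (C * (l x / r x ^ 2)) := by ring
        rw [h9]; linarith
    have h4 := h3 ha hb hab.le
    simp only at h4
    rw [one_div, one_div]
    nlinarith
  set I := z b - z a with hI
  have hA : 2 * (w b - w a) = η * r b := by rw [hη]; field_simp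
  have hIB : I ^ 2 ≤ η * r b * (C * (1 / r a - 1 / r b)) := by
    have h3 := hCS (I / (η * r b))
    rw [hA] at h3
    have hp : 0 < η * r b := by positivity
    have h4 : (I / (η * r b)) ^ 2 * (η * r b) - 2 * (I / (η * r b)) * I = - (I ^ 2 / (η * r b)) := by
      field_simp; ring
    have h5 : I ^ 2 / (η * r b) ≤ C * (1 / r a - 1 / r b) := by linarith
    rw [div_le_iff₀ hp] at h5
    linarith
  have he1 : 1 < Real.exp η := Real.one_lt_exp_iff.2 hη0
  have he : 0 < Real.exp η - 1 := by linarith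
  have hkk : 0 < k b - k a := by nlinarith
  set δ := (r b - r a) / r a with hδ
  have hδ0 : 0 ≤ δ := div_nonneg (sub_nonneg.2 (hrm ha hb hab.le)) ra.le
  have hIB2 : I ^ 2 ≤ k b * (n b * η * (E * δ)) := by
    have : η * r b * (C * (1 / r a - 1 / r b)) = k b * (n b * η * (E * δ)) := by
      rw [hC, hδ]; field_simp
    linarith
  have hst : z b ^ 2 / k b - z a ^ 2 / k a ≤ I ^ 2 / (k b - k a) := by
    have : I ^ 2 / (k b - k a) - (z b ^ 2 / k b - z a ^ 2 / k a)
        = (k b * z a - k a * z b) ^ 2 / (k a * k b * (k b - k a)) := by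
      rw [hI]
      have := hkk.ne'
      field_simp
      ring
    have : 0 ≤ (k b * z a - k a * z b) ^ 2 / (k a * k b * (k b - k a)) := by positivity
    linarith
  have hkf : k b / (k b - k a) ≤ 1 + 1 / (Real.exp η - 1) := by
    have : 1 + 1 / (Real.exp η - 1) = Real.exp η / (Real.exp η - 1) := by
      field_simp; ring
    rw [this, div_le_div_iff₀ hkk he]
    nlinarith
  have hQ : 0 ≤ n b * η * (E * δ) := by positivity
  calc _ ≤ I ^ 2 / (k b - k a) := hst
    _ ≤ k b * (n b * η * (E * δ)) / (k b - k a) := by gcongr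
    _ = n b * η * (E * δ) * (k b / (k b - k a)) := by ring
    _ ≤ n b * η * (E * δ) * (1 + 1 / (Real.exp η - 1)) := by gcongr
    _ = _ := by ring

theorem aux_diff_v (f : ℝ × ℝ → ℝ) (O : Set (ℝ × ℝ)) (hO : IsOpen O)
    (hf : DifferentiableOn ℝ f O) (u v : ℝ) (h : (u, v) ∈ O) :
    HasDerivAt (fun x => f (u, x)) (pdv f (u, v)) v := by
  have h1 : DifferentiableAt ℝ f (u, v) := hf.differentiableAt (hO.mem_nhds h)
  have h2 : DifferentiableAt ℝ (fun x : ℝ => f (u, x)) v :=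
    DifferentiableAt.comp v (f := fun x : ℝ => (u, x)) h1 (by fun_prop)
  exact h2.hasDerivAt

theorem aux_diff_u (f : ℝ × ℝ → ℝ) (O : Set (ℝ × ℝ)) (hO : IsOpen O)
    (hf : DifferentiableOn ℝ f O) (u v : ℝ) (h : (u, v) ∈ O) :
    HasDerivAt (fun x => f (x, v)) (pdu f (u, v)) u := by
  have h1 : DifferentiableAt ℝ f (u, v) := hf.differentiableAt (hO.mem_nhds h)
  have h2 : DifferentiableAt ℝ (fun x : ℝ => f (x, v)) u :=
    DifferentiableAt.comp u (f := fun x : ℝ => (x, v)) h1 (by fun_prop)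
  exact h2.hasDerivAt

theorem aux_pdu_diff (f : ℝ × ℝ → ℝ) (O : Set (ℝ × ℝ)) (hO : IsOpen O)
    (hf : ContDiffOn ℝ (⊤ : ℕ∞) f O) : DifferentiableOn ℝ (pdu f) O := by
  have hd : DifferentiableOn ℝ f O := hf.differentiableOn (by simp)
  have h1 : ContDiffOn ℝ 1 (fderiv ℝ f) O := hf.fderiv_of_isOpen hO (WithTop.coe_le_coe.2 (le_top : (1 + 1 : ℕ∞) ≤ ⊤))
  have h2 : DifferentiableOn ℝ (fun p => fderiv ℝ f p (1, 0)) O :=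
    (h1.differentiableOn (by simp)).clm_apply (differentiableOn_const _)
  refine h2.congr ?_
  rintro ⟨u, v⟩ hp
  have h3 : HasFDerivAt f (fderiv ℝ f (u, v)) (u, v) :=
    (hd.differentiableAt (hO.mem_nhds hp)).hasFDerivAt
  have h4 : HasDerivAt (fun x : ℝ => (x, v)) ((1 : ℝ), (0 : ℝ)) u :=
    (hasDerivAt_id u).prodMk (hasDerivAt_const u v)
  exact (HasFDerivAt.comp_hasDerivAt u h3 h4).deriv

theorem stmt10 (Λ R : ℝ) (hΛ : 0 < Λ) (hR : 0 < R) (hΛR : Λ * R ^ 2 < 1)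
    (r ϖ θ ζ κ κb : ℝ × ℝ → ℝ) (U v₁ v₂ : ℝ) (hU : 0 ≤ U) (hv₁ : 0 < v₁) (hv₁₂ : v₁ < v₂)
    (O : Set (ℝ × ℝ)) (hO : IsOpen O) (hSO : Icc 0 U ×ˢ Icc v₁ v₂ ⊆ O)
    (hr : ContDiffOn ℝ (⊤ : ℕ∞) r O) (hϖ : ContDiffOn ℝ (⊤ : ℕ∞) ϖ O)
    (hθ : ContDiffOn ℝ (⊤ : ℕ∞) θ O) (hζ : ContDiffOn ℝ (⊤ : ℕ∞) ζ O)
    (hκ : ContDiffOn ℝ (⊤ : ℕ∞) κ O) (hκb : ContDiffOn ℝ (⊤ : ℕ∞) κb O)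
    (hsys : ∀ p ∈ Icc 0 U ×ˢ Icc v₁ v₂, FirstOrderSystem Λ r ϖ θ ζ κ κb p)
    (hnt : ∀ p ∈ Icc 0 U ×ˢ Icc v₁ v₂, NonTrappedAt Λ r ϖ κ κb p)
    (hrbd : ∀ p ∈ Icc 0 U ×ˢ Icc v₁ v₂, 0 < r p ∧ r p ≤ R) :
    ∀ u ∈ Icc 0 U, 0 < 2 * (ϖ (u, v₂) - ϖ (u, v₁)) / r (u, v₂) →
      deriv (fun s => 2 * (ϖ (s, v₂) - ϖ (s, v₁)) / r (s, v₂)) u ≥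
        (-pdu r (u, v₂) / r (u, v₂)) * (2 * (ϖ (u, v₂) - ϖ (u, v₁)) / r (u, v₂)) *
          (1 - Real.exp (2 * Λ / 3 * R ^ 2 / (1 - Λ * R ^ 2)) *
            ((r (u, v₂) - r (u, v₁)) / r (u, v₁)) *
            (1 + 1 / (Real.exp (2 * (ϖ (u, v₂) - ϖ (u, v₁)) / r (u, v₂)) - 1))) := by
  intro u hu hη0
  have hmem : ∀ x ∈ Icc v₁ v₂, (u, x) ∈ Icc 0 U ×ˢ Icc v₁ v₂ := fun x hx => ⟨hu, hx⟩
  have hb : v₂ ∈ Icc v₁ v₂ := right_mem_Icc.2 hv₁₂.le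
  have ha : v₁ ∈ Icc v₁ v₂ := left_mem_Icc.2 hv₁₂.le
  have hrd : DifferentiableOn ℝ r O := hr.differentiableOn (by simp)
  have hϖd : DifferentiableOn ℝ ϖ O := hϖ.differentiableOn (by simp)
  have hζd : DifferentiableOn ℝ ζ O := hζ.differentiableOn (by simp)
  have hκbd : DifferentiableOn ℝ κb O := hκb.differentiableOn (by simp)
  have hνd := aux_pdu_diff r O hO hr
  have core := aux_core Λ R v₁ v₂ hΛ hR hΛR hv₁₂ (fun x => r (u, x)) (fun x => ϖ (u, x))
    (fun x => ζ (u, x)) (fun x => -κb (u, x)) (fun x => -pdu r (u, x)) (fun x => pdv r (u, x))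
    (fun x => θ (u, x)) (fun x => κ (u, x)) (fun x => oneMinusMu Λ r ϖ (u, x))
    (fun x hx => aux_diff_v r O hO hrd u x (hSO (hmem x hx)))
    (fun x hx => by
      have h := aux_diff_v ϖ O hO hϖd u x (hSO (hmem x hx))
      obtain ⟨-, -, -, e, -⟩ := hsys _ (hmem x hx)
      rwa [e] at h)
    (fun x hx => by
      have h := aux_diff_v ζ O hO hζd u x (hSO (hmem x hx))
      obtain ⟨-, -, -, -, -, e, -⟩ := hsys _ (hmem x hx)
      rw [e] at h
      refine HasDerivAt.congr_deriv h ?_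
      ring)
    (fun x hx => by
      have h := (aux_diff_v κb O hO hκbd u x (hSO (hmem x hx))).neg
      obtain ⟨-, -, -, -, -, -, e, -⟩ := hsys _ (hmem x hx)
      rw [e] at h
      refine HasDerivAt.congr_deriv h ?_
      ring)
    (fun x hx => by
      have h := (aux_diff_v (pdu r) O hO hνd u x (hSO (hmem x hx))).neg
      obtain ⟨-, e, -⟩ := hsys _ (hmem x hx)
      rw [e] at h
      refine HasDerivAt.congr_deriv h ?_
      simp only [drOneMinusMu]
      ring)
    (fun x hx => rfl)
    (fun x hx => by
      obtain ⟨-, -, -, -, -, -, -, -, e, -⟩ := hsys _ (hmem x hx)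
      simp only [e]
      ring)
    (fun x hx => (hsys _ (hmem x hx)).2.2.2.2.2.2.2.2.2)
    (fun x hx => (hnt _ (hmem x hx)).2.2.2.2.2.1)
    (fun x hx => (hnt _ (hmem x hx)).2.2.2.2.2.2)
    (fun x hx => neg_pos.2 (hnt _ (hmem x hx)).2.2.2.1)
    (fun x hx => (hnt _ (hmem x hx)).2.2.1)
    (fun x hx => (hnt _ (hmem x hx)).2.2.2.2.1)
    (fun x hx => (hrbd _ (hmem x hx)).1)
    (fun x hx => (hrbd _ (hmem x hx)).2)
    _ rfl hη0
  have rb : 0 < r (u, v₂) := (hrbd _ (hmem _ hb)).1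
  have hD := (((aux_diff_u ϖ O hO hϖd u v₂ (hSO (hmem _ hb))).sub
    (aux_diff_u ϖ O hO hϖd u v₁ (hSO (hmem _ ha)))).const_mul 2).div
    (aux_diff_u r O hO hrd u v₂ (hSO (hmem _ hb))) rb.ne'
  have hD' : deriv (fun s => 2 * (ϖ (s, v₂) - ϖ (s, v₁)) / r (s, v₂)) u = _ := hD.deriv
  rw [hD']
  obtain ⟨-, -, eb, -⟩ := hsys _ (hmem _ hb)
  obtain ⟨-, -, ea, -⟩ := hsys _ (hmem _ ha)
  rw [eb, ea]
  have kb : κb (u, v₂) < 0 := (hnt _ (hmem _ hb)).2.2.2.1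
  have ka : κb (u, v₁) < 0 := (hnt _ (hmem _ ha)).2.2.2.1
  simp only [Pi.sub_apply]
  generalize hX : Real.exp (2 * Λ / 3 * R ^ 2 / (1 - Λ * R ^ 2)) *
            ((r (u, v₂) - r (u, v₁)) / r (u, v₁)) *
            (1 + 1 / (Real.exp (2 * (ϖ (u, v₂) - ϖ (u, v₁)) / r (u, v₂)) - 1)) = X at core ⊢
  generalize hη : 2 * (ϖ (u, v₂) - ϖ (u, v₁)) / r (u, v₂) = η at core ⊢
  have hA : 2 * (ϖ (u, v₂) - ϖ (u, v₁)) = η * r (u, v₂) := by rw [← hη]; field_simp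
  rw [hA]
  have e1 : (2 * (ζ (u, v₂) ^ 2 / (2 * κb (u, v₂)) - ζ (u, v₁) ^ 2 / (2 * κb (u, v₁))) * r (u, v₂)
      - η * r (u, v₂) * pdu r (u, v₂)) / r (u, v₂) ^ 2
      = (-(ζ (u, v₂) ^ 2 / -κb (u, v₂) - ζ (u, v₁) ^ 2 / -κb (u, v₁))
        + -pdu r (u, v₂) * η) / r (u, v₂) := by
    have := kb.ne
    have := ka.ne
    field_simp
    ring
  have e2 : -pdu r (u, v₂) / r (u, v₂) * η * (1 - X)
      = (-(-pdu r (u, v₂) * η * X) + -pdu r (u, v₂) * η) / r (u, v₂) := by ring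
  rw [ge_iff_le, e2]
  refine le_trans ?_ e1.ge
  gcongr
end

section
/- Let α ≥ 0 and δ₀ > 0 with 1 + δ₀ − e^{α}δ₀ > 0; set x₀ := e^{α}δ₀/(1+δ₀), f(y) := e^{2α}δ₀/( y(δ₀+1) − e^{α}δ₀ ) for y ∈ (x₀,1], G(x) := ∫_x^1 (1 − f(y))/y dy, F(x) := ∫_x^1 (f(y)/y) e^{−G(y)} dy, and H(x) := F(x) + e^{−G(x)} on (x₀,1]. Then H is differentiable with H′(x) = (e^{−G(x)}/x)(1 − 2f(x)) for all x ∈ (x₀,1], and if x₁ := (2e^{α}+1)e^{α}δ₀/(1+δ₀) satisfies x₁ < 1, then x₁ is the unique critical point of H in (x₀,1], with H′(x) < 0 for x ∈ (x₀,x₁) and H′(x) > 0 for x ∈ (x₁,1]; in particular x₁ is the global minimum point of H on (x₀,1]. -/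
open Set

/-- The upper bound `f(y) = e^{2α}δ₀ / (y(δ₀+1) - e^{α}δ₀)` for `e^{α}δ(u)` in the
rescaled radius variable. -/
noncomputable def fBound (α δ₀ y : ℝ) : ℝ :=
  Real.exp (2 * α) * δ₀ / (y * (δ₀ + 1) - Real.exp α * δ₀)

/-- The integrating-factor exponent `G(x) = ∫_x^1 (1 - f(y))/y dy`. -/
noncomputable def GFun (α δ₀ x : ℝ) : ℝ :=
  ∫ y in x..1, (1 - fBound α δ₀ y) / y

/-- The source term `F(x) = ∫_x^1 (f(y)/y) e^{-G(y)} dy`. -/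
noncomputable def FFun (α δ₀ x : ℝ) : ℝ :=
  ∫ y in x..1, fBound α δ₀ y / y * Real.exp (-(GFun α δ₀ y))

/-- The critical point `x₁ = (2e^{α}+1)e^{α}δ₀/(1+δ₀)`. -/
noncomputable def xOne (α δ₀ : ℝ) : ℝ :=
  (2 * Real.exp α + 1) * Real.exp α * δ₀ / (1 + δ₀)

/-- `H = F + e^{-G}`. -/
noncomputable def HFun (α δ₀ x : ℝ) : ℝ :=
  FFun α δ₀ x + Real.exp (-(GFun α δ₀ x))

theorem aux_deriv (g : ℝ → ℝ) (a : ℝ) (ha : a < 1) (hg : ContinuousOn g (Ioi a)) (x : ℝ)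
    (hx : a < x) : HasDerivAt (fun x => ∫ y in x..1, g y) (-g x) x := by
  have hsub : uIcc x 1 ⊆ Ioi a := by
    intro y hy
    exact lt_of_lt_of_le (lt_min hx ha) hy.1
  apply intervalIntegral.integral_hasDerivAt_left
  · exact (hg.mono hsub).intervalIntegrable
  · exact hg.stronglyMeasurableAtFilter isOpen_Ioi x hx
  · exact hg.continuousAt (Ioi_mem_nhds hx)

theorem stmt14 (α δ₀ : ℝ) (hα : 0 ≤ α) (hδ₀ : 0 < δ₀)
    (hpos : 0 < 1 + δ₀ - Real.exp α * δ₀)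
    (hx₁lt : xOne α δ₀ < 1) :
    (∀ x ∈ Ioc (Real.exp α * δ₀ / (1 + δ₀)) 1,
        HasDerivAt (HFun α δ₀)
          (Real.exp (-(GFun α δ₀ x)) / x * (1 - 2 * fBound α δ₀ x)) x) ∧
    (∀ x ∈ Ioc (Real.exp α * δ₀ / (1 + δ₀)) 1,
        (Real.exp (-(GFun α δ₀ x)) / x * (1 - 2 * fBound α δ₀ x) = 0 ↔ x = xOne α δ₀)) ∧
    (∀ x ∈ Ioo (Real.exp α * δ₀ / (1 + δ₀)) (xOne α δ₀),
        Real.exp (-(GFun α δ₀ x)) / x * (1 - 2 * fBound α δ₀ x) < 0) ∧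
    (∀ x ∈ Ioc (xOne α δ₀) 1,
        0 < Real.exp (-(GFun α δ₀ x)) / x * (1 - 2 * fBound α δ₀ x)) ∧
    (∀ x ∈ Ioc (Real.exp α * δ₀ / (1 + δ₀)) 1, HFun α δ₀ (xOne α δ₀) ≤ HFun α δ₀ x) := by
  have he : 0 < Real.exp α := Real.exp_pos α
  have hd : 0 < 1 + δ₀ := by linarith
  set a := Real.exp α * δ₀ / (1 + δ₀) with ha
  have ha0 : 0 < a := by positivity
  have ha1 : a < 1 := by rw [ha, div_lt_one hd]; linarith
  have hae : a * (1 + δ₀) = Real.exp α * δ₀ := by rw [ha]; field_simp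
  have hD : ∀ y, a < y → 0 < y * (δ₀ + 1) - Real.exp α * δ₀ := by
    intro y hy
    nlinarith [mul_lt_mul_of_pos_right hy hd]
  have hax : a < xOne α δ₀ := by
    unfold xOne
    rw [ha]
    apply div_lt_div_of_pos_right _ hd
    nlinarith [mul_pos he (mul_pos he hδ₀)]
  have hxe : xOne α δ₀ * (1 + δ₀) = (2 * Real.exp α + 1) * Real.exp α * δ₀ := by
    unfold xOne; field_simp
  have hfc : ContinuousOn (fBound α δ₀) (Ioi a) := by
    unfold fBound
    apply ContinuousOn.div (by fun_prop) (by fun_prop)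
    intro y hy
    exact (hD y hy).ne'
  have hg1 : ContinuousOn (fun y => (1 - fBound α δ₀ y) / y) (Ioi a) := by
    apply ContinuousOn.div (by fun_prop) (by fun_prop)
    intro y hy
    exact (ha0.trans hy).ne'
  have hG : ∀ x, a < x → HasDerivAt (GFun α δ₀) (-((1 - fBound α δ₀ x) / x)) x :=
    fun x hx => aux_deriv _ a ha1 hg1 x hx
  have hGc : ContinuousOn (GFun α δ₀) (Ioi a) :=
    fun x hx => (hG x hx).continuousAt.continuousWithinAt
  have hg2 : ContinuousOn (fun y => fBound α δ₀ y / y * Real.exp (-(GFun α δ₀ y))) (Ioi a) := by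
    apply ContinuousOn.mul
    · apply ContinuousOn.div hfc (by fun_prop)
      intro y hy
      exact (ha0.trans hy).ne'
    · exact Real.continuous_exp.comp_continuousOn hGc.neg
  have hF : ∀ x, a < x → HasDerivAt (FFun α δ₀)
      (-(fBound α δ₀ x / x * Real.exp (-(GFun α δ₀ x)))) x :=
    fun x hx => aux_deriv _ a ha1 hg2 x hx
  have hH : ∀ x, a < x → HasDerivAt (HFun α δ₀)
      (Real.exp (-(GFun α δ₀ x)) / x * (1 - 2 * fBound α δ₀ x)) x := by
    intro x hx
    have h := (hF x hx).add ((hG x hx).neg.exp)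
    refine HasDerivAt.congr_deriv h ?_
    have : x ≠ 0 := (ha0.trans hx).ne'
    simp only [Pi.neg_apply]
    field_simp
    ring
  have key : ∀ x, a < x → ∃ c : ℝ, 0 < c ∧
      Real.exp (-(GFun α δ₀ x)) / x * (1 - 2 * fBound α δ₀ x) = c * (x - xOne α δ₀) := by
    intro x hx
    have h1 := hD x hx
    have hx0 : 0 < x := ha0.trans hx
    refine ⟨Real.exp (-(GFun α δ₀ x)) / x *
      ((1 + δ₀) / (x * (δ₀ + 1) - Real.exp α * δ₀)), by positivity, ?_⟩
    rw [mul_assoc]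
    congr 1
    have h2 : Real.exp (2 * α) = Real.exp α * Real.exp α := by
      rw [← Real.exp_add]; ring_nf
    unfold fBound
    rw [h2, div_mul_eq_mul_div, eq_div_iff h1.ne', sub_mul, mul_assoc, div_mul_cancel₀ _ h1.ne']
    linear_combination hxe
  have hneg : ∀ x ∈ Ioo a (xOne α δ₀),
      Real.exp (-(GFun α δ₀ x)) / x * (1 - 2 * fBound α δ₀ x) < 0 := by
    intro x hx
    obtain ⟨c, hc, h⟩ := key x hx.1
    rw [h]
    exact mul_neg_of_pos_of_neg hc (by linarith [hx.2])
  have hpos' : ∀ x, xOne α δ₀ < x →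
      0 < Real.exp (-(GFun α δ₀ x)) / x * (1 - 2 * fBound α δ₀ x) := by
    intro x hx
    obtain ⟨c, hc, h⟩ := key x (hax.trans hx)
    rw [h]
    exact mul_pos hc (by linarith)
  refine ⟨fun x hx => hH x hx.1, ?_, hneg, fun x hx => hpos' x hx.1, ?_⟩
  · intro x hx
    obtain ⟨c, hc, h⟩ := key x hx.1
    rw [h, mul_eq_zero, or_iff_right hc.ne', sub_eq_zero]
  · intro x hx
    rcases le_total x (xOne α δ₀) with hle | hle
    · have hanti : AntitoneOn (HFun α δ₀) (Icc x (xOne α δ₀)) := by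
        apply antitoneOn_of_deriv_nonpos (convex_Icc _ _)
        · intro y hy
          exact (hH y (hx.1.trans_le hy.1)).continuousAt.continuousWithinAt
        · intro y hy
          rw [interior_Icc] at hy
          exact (hH y (hx.1.trans hy.1)).differentiableAt.differentiableWithinAt
        · intro y hy
          rw [interior_Icc] at hy
          rw [(hH y (hx.1.trans hy.1)).deriv]
          exact (hneg y ⟨hx.1.trans hy.1, hy.2⟩).le
      exact hanti (left_mem_Icc.2 hle) (right_mem_Icc.2 hle) hle
    · have hmono : MonotoneOn (HFun α δ₀) (Icc (xOne α δ₀) x) := by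
        apply monotoneOn_of_deriv_nonneg (convex_Icc _ _)
        · intro y hy
          exact (hH y (hax.trans_le hy.1)).continuousAt.continuousWithinAt
        · intro y hy
          rw [interior_Icc] at hy
          exact (hH y (hax.trans hy.1)).differentiableAt.differentiableWithinAt
        · intro y hy
          rw [interior_Icc] at hy
          rw [(hH y (hax.trans hy.1)).deriv]
          exact (hpos' y hy.1).le
      exact hmono (left_mem_Icc.2 hle) (right_mem_Icc.2 hle) hle
end

section
/- Fix α ≥ 0. For δ₀ > 0 with 1 + δ₀ − e^{α}δ₀ > 0 set x₀ := e^{α}δ₀/(1+δ₀), f(y) := e^{2α}δ₀/( y(δ₀+1) − e^{α}δ₀ ) for y ∈ (x₀,1], G(x) := ∫_x^1 (1 − f(y))/y dy, and x₁ = x₁(δ₀) := (2e^{α}+1)e^{α}δ₀/(1+δ₀). Then there exist constants c₁ > 0, C₁ > 0 and δ₁ > 0 such that for all 0 < δ₀ < δ₁: c₁ δ₀ ≤ e^{−G(x₁(δ₀))} ≤ C₁ δ₀. -/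
open Set

theorem GFun_formula (α δ x₀ x : ℝ) (hδ : 0 < δ) (hx₀ : x₀ = Real.exp α * δ / (1 + δ))
    (h1 : x₀ < 1) (hx : x₀ < x) :
    GFun α δ x = -(Real.exp α * Real.log (1 - x₀))
      - ((1 + Real.exp α) * Real.log x - Real.exp α * Real.log (x - x₀)) := by
  have ha := Real.exp_pos α
  have hp : 0 < x₀ := by rw [hx₀]; positivity
  have hmem : ∀ y ∈ uIcc x 1, x₀ < y := by
    intro y hy
    exact lt_of_lt_of_le (lt_min hx h1) hy.1
  have hne : ∀ y ∈ uIcc x 1, y ≠ 0 ∧ y * (δ + 1) - Real.exp α * δ ≠ 0 := by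
    intro y hy
    have h := hmem y hy
    refine ⟨by linarith, ?_⟩
    have : Real.exp α * δ = x₀ * (δ + 1) := by rw [hx₀]; field_simp; ring
    rw [this, ← sub_mul]
    have : 0 < y - x₀ := by linarith
    positivity
  unfold GFun
  rw [intervalIntegral.integral_eq_sub_of_hasDerivAt
    (f := fun y => (1 + Real.exp α) * Real.log y - Real.exp α * Real.log (y - x₀))]
  · simp
  · intro y hy
    have h := hmem y hy
    have hy0 : y ≠ 0 := by linarith
    have hy1 : y - x₀ ≠ 0 := by linarith
    have d := ((Real.hasDerivAt_log hy0).const_mul (1 + Real.exp α)).sub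
      ((((hasDerivAt_id y).sub_const x₀).log hy1).const_mul (Real.exp α))
    refine HasDerivAt.congr_deriv (f := fun y => (1 + Real.exp α) * Real.log y - Real.exp α * Real.log (y - x₀)) d ?_
    symm
    have e1 : Real.exp α * δ = x₀ * (δ + 1) := by rw [hx₀]; field_simp; ring
    have e2 : Real.exp (2 * α) * δ = Real.exp α * x₀ * (δ + 1) := by
      rw [two_mul, Real.exp_add, mul_assoc, e1]; ring
    have e3 : fBound α δ y = Real.exp α * x₀ / (y - x₀) := by
      unfold fBound
      rw [e1, e2, ← sub_mul, mul_div_mul_right _ _ (by positivity)]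
    rw [e3]
    simp only [id]
    field_simp
    ring
  · apply ContinuousOn.intervalIntegrable
    unfold fBound
    refine ContinuousOn.div (continuousOn_const.sub (ContinuousOn.div continuousOn_const
      (by fun_prop) fun y hy => (hne y hy).2)) continuousOn_id fun y hy => (hne y hy).1

theorem stmt15 (α : ℝ) (hα : 0 ≤ α) :
    ∃ c₁ C₁ δ₁ : ℝ, 0 < c₁ ∧ 0 < C₁ ∧ 0 < δ₁ ∧
      ∀ δ₀ : ℝ, 0 < δ₀ → δ₀ < δ₁ → 0 < 1 + δ₀ - Real.exp α * δ₀ →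
        c₁ * δ₀ ≤ Real.exp (-(GFun α δ₀ (xOne α δ₀))) ∧
          Real.exp (-(GFun α δ₀ (xOne α δ₀))) ≤ C₁ * δ₀ := by
  have ha := Real.exp_pos α
  have ha1 : 1 ≤ Real.exp α := Real.one_le_exp hα
  set a := Real.exp α with hadef
  set K := Real.exp ((1 + a) * Real.log (2 * a + 1) - a * Real.log (2 * a)) with hK
  have hKp : 0 < K := Real.exp_pos _
  refine ⟨K * (a / 2) * Real.exp (a * Real.log (1 / 2)), K * a, 1 / (2 * a),
    by positivity, by positivity, by positivity, ?_⟩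
  intro δ hδ hδ1 _
  have haδ : a * δ < 1 / 2 := by
    rw [lt_div_iff₀ (by positivity)] at hδ1
    linarith
  have hδ2 : δ ≤ 1 := by nlinarith
  obtain ⟨x₀, hx₀⟩ : ∃ x₀, x₀ = a * δ / (1 + δ) := ⟨_, rfl⟩
  have hp : 0 < x₀ := by rw [hx₀]; positivity
  have hle : x₀ ≤ a * δ := by
    rw [hx₀]; exact div_le_self (by positivity) (by linarith)
  have hge : a / 2 * δ ≤ x₀ := by
    rw [hx₀, le_div_iff₀ (by positivity)]
    nlinarith [mul_pos ha hδ]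
  have hx1 : xOne α δ = (2 * a + 1) * x₀ := by
    unfold xOne; rw [hx₀]; ring
  have key : Real.exp (-(GFun α δ (xOne α δ))) = K * x₀ * Real.exp (a * Real.log (1 - x₀)) := by
    rw [hx1, GFun_formula α δ x₀ _ hδ hx₀ (by linarith) (by nlinarith)]
    rw [← hadef, show (2 * a + 1) * x₀ - x₀ = 2 * a * x₀ by ring,
      Real.log_mul (by positivity) hp.ne', Real.log_mul (by positivity) hp.ne']
    have e : K * x₀ * Real.exp (a * Real.log (1 - x₀))
        = K * Real.exp (Real.log x₀) * Real.exp (a * Real.log (1 - x₀)) := by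
      rw [Real.exp_log hp]
    rw [e, hK, ← Real.exp_add, ← Real.exp_add]
    congr 1
    ring
  rw [key]
  constructor
  · have h1 : Real.exp (a * Real.log (1 / 2)) ≤ Real.exp (a * Real.log (1 - x₀)) := by
      apply Real.exp_le_exp.mpr
      apply mul_le_mul_of_nonneg_left _ ha.le
      exact Real.log_le_log (by norm_num) (by linarith)
    calc K * (a / 2) * Real.exp (a * Real.log (1 / 2)) * δ
        = K * (a / 2 * δ) * Real.exp (a * Real.log (1 / 2)) := by ring
      _ ≤ _ := by gcongr
  · have h1 : Real.exp (a * Real.log (1 - x₀)) ≤ 1 := by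
      rw [Real.exp_le_one_iff]
      exact mul_nonpos_of_nonneg_of_nonpos ha.le
        (Real.log_nonpos (by linarith) (by linarith))
    calc K * x₀ * Real.exp (a * Real.log (1 - x₀)) ≤ K * x₀ * 1 := by gcongr
      _ ≤ K * (a * δ) * 1 := by gcongr
      _ = _ := by ring
end

section
/- Fix α ≥ 0. For δ₀ > 0 with 1 + δ₀ − e^{α}δ₀ > 0 set x₀ := e^{α}δ₀/(1+δ₀), f(y) := e^{2α}δ₀/( y(δ₀+1) − e^{α}δ₀ ) for y ∈ (x₀,1], G(x) := ∫_x^1 (1 − f(y))/y dy, F(x) := ∫_x^1 (f(y)/y) e^{−G(y)} dy, and x₁ = x₁(δ₀) := (2e^{α}+1)e^{α}δ₀/(1+δ₀). Then there exist constants c₁ > 0, C₁ > 0 and δ₁ > 0 such that for all 0 < δ₀ < δ₁: c₁ δ₀ log(1/δ₀) ≤ F(x₁(δ₀)) ≤ C₁ δ₀ log(1/δ₀). -/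
open Set

lemma aux_f_bounds {a d y : ℝ} (ha : 1 ≤ a) (hd : 0 < d)
    (hy : (2 * a + 1) * a * d / (1 + d) ≤ y) :
    0 < y ∧ 0 < y * (d + 1) - a * d ∧
    d / (1 + d) / y ≤ a ^ 2 * d / (y * (d + 1) - a * d) ∧
    a ^ 2 * d / (y * (d + 1) - a * d) ≤ (a * (2 * a + 1) / 2) * d / (1 + d) / y := by
  have h1 : (0:ℝ) < 1 + d := by linarith
  have ha0 : 0 < a := by linarith
  have hy0 : 0 < y := lt_of_lt_of_le (by positivity) hy
  rw [div_le_iff₀ h1] at hy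
  have had : 0 < a * d := by positivity
  have h2 : 0 < y * (d + 1) - a * d := by nlinarith [mul_pos ha0 had]
  refine ⟨hy0, h2, ?_, ?_⟩
  · rw [div_div, div_le_div_iff₀ (by positivity) h2]
    have e1 : d * (y * (d + 1) - a * d) ≤ d * ((1 + d) * y) := by
      apply mul_le_mul_of_nonneg_left _ hd.le; nlinarith
    have e2 : d * ((1 + d) * y) ≤ a ^ 2 * (d * ((1 + d) * y)) :=
      le_mul_of_one_le_left (by positivity) (by nlinarith)
    linarith
  · rw [div_div, div_le_div_iff₀ h2 (by positivity)]
    have := mul_le_mul_of_nonneg_left hy had.le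
    nlinarith

lemma aux_fcont (α d x : ℝ) (hd : 0 < d) (hα : 0 ≤ α) (hx : xOne α d ≤ x) :
    ContinuousOn (fun y => fBound α d y) (Icc x 1) := by
  unfold fBound
  apply ContinuousOn.div (by fun_prop) (by fun_prop)
  intro y hy
  exact (aux_f_bounds (Real.one_le_exp hα) hd (le_trans hx hy.1)).2.1.ne'

lemma aux_gcont (α d x : ℝ) (hd : 0 < d) (hα : 0 ≤ α) (hx : xOne α d ≤ x) :
    ContinuousOn (fun y => (1 - fBound α d y) / y) (Icc x 1) := by
  apply ContinuousOn.div (continuousOn_const.sub (aux_fcont α d x hd hα hx)) continuousOn_id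
  intro y hy
  exact (aux_f_bounds (Real.one_le_exp hα) hd (le_trans hx hy.1)).1.ne'

lemma aux_fb {α d y : ℝ} (hα : 0 ≤ α) (hd : 0 < d) (hy : xOne α d ≤ y) :
    0 < y ∧ d / (1 + d) / y ≤ fBound α d y ∧
    fBound α d y ≤ (Real.exp α * (2 * Real.exp α + 1) / 2) * d / (1 + d) / y := by
  have h := aux_f_bounds (Real.one_le_exp hα) hd hy
  have e : Real.exp (2 * α) = Real.exp α ^ 2 := by
    rw [sq, ← Real.exp_add]; congr 1; ring
  unfold fBound
  rw [e]
  exact ⟨h.1, h.2.2⟩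

lemma aux_G {α d x : ℝ} (hα : 0 ≤ α) (hd : 0 < d) (hx : xOne α d ≤ x) (hx1 : x ≤ 1) :
    x ≤ Real.exp (-(GFun α d x)) ∧ Real.exp (-(GFun α d x)) ≤ Real.exp (1/2) * x := by
  have hx0 : 0 < x := (aux_fb hα hd hx).1
  have hint : IntervalIntegrable (fun y => (1 - fBound α d y) / y) MeasureTheory.volume x 1 := by
    apply ContinuousOn.intervalIntegrable
    rw [uIcc_of_le hx1]; exact aux_gcont α d x hd hα hx
  set c := (Real.exp α * (2 * Real.exp α + 1) / 2) * d / (1 + d) with hc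
  have hc0 : 0 < c := by positivity
  have hcx : c / x ≤ 1 / 2 := by
    rw [div_le_iff₀ hx0]
    have : c = 1 / 2 * xOne α d := by unfold xOne; rw [hc]; ring
    rw [this]; linarith
  have hinv : ∀ k : ℝ, (∫ y in x..1, (1 / y - k / y ^ 2)) = k - (Real.log x + k / x) ∧
      IntervalIntegrable (fun y => 1 / y - k / y ^ 2) MeasureTheory.volume x 1 := by
    intro k
    have hi : IntervalIntegrable (fun y => 1 / y - k / y ^ 2) MeasureTheory.volume x 1 := by
      apply ContinuousOn.intervalIntegrable
      rw [uIcc_of_le hx1]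
      apply ContinuousOn.sub
      · exact continuousOn_const.div continuousOn_id (fun y hy => (lt_of_lt_of_le hx0 hy.1).ne')
      · exact continuousOn_const.div (by fun_prop)
          (fun y hy => (pow_pos (lt_of_lt_of_le hx0 hy.1) 2).ne')
    refine ⟨?_, hi⟩
    rw [intervalIntegral.integral_eq_sub_of_hasDerivAt (f := fun y => Real.log y + k * y⁻¹) _ hi]
    · simp [div_eq_mul_inv]
    · intro y hy
      rw [uIcc_of_le hx1] at hy
      have hy0 : y ≠ 0 := (lt_of_lt_of_le hx0 hy.1).ne'
      convert (Real.hasDerivAt_log hy0).add ((hasDerivAt_inv hy0).const_mul k) using 1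
      · rfl
      · ring
  have up : GFun α d x ≤ - Real.log x := by
    have h := intervalIntegral.integral_mono_on hx1 hint (hinv 0).2 (fun y hy => by
      have hb := aux_fb hα hd (hx.trans hy.1)
      have hp : 0 ≤ fBound α d y := le_trans (by have := hb.1; positivity) hb.2.1
      have := hb.1
      simp only [zero_div, sub_zero]
      gcongr
      linarith)
    rw [(hinv 0).1] at h
    unfold GFun
    simpa using h
  have lo : - Real.log x - 1/2 ≤ GFun α d x := by
    have h := intervalIntegral.integral_mono_on hx1 (hinv c).2 hint (fun y hy => by
      have hb := aux_fb hα hd (hx.trans hy.1)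
      have h0 := hb.1
      have e : 1 / y - c / y ^ 2 = (1 - c / y) / y := by field_simp
      rw [e]
      gcongr
      exact hb.2.2)
    rw [(hinv c).1] at h
    unfold GFun
    linarith
  constructor
  · calc x = Real.exp (Real.log x) := (Real.exp_log hx0).symm
      _ ≤ _ := Real.exp_le_exp.2 (by linarith)
  · calc _ ≤ Real.exp (1/2 + Real.log x) := Real.exp_le_exp.2 (by linarith)
      _ = _ := by rw [Real.exp_add, Real.exp_log hx0]

lemma aux_F {α d : ℝ} (hα : 0 ≤ α) (hd : 0 < d) (hx1 : xOne α d ≤ 1) :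
    d / (1 + d) * (- Real.log (xOne α d)) ≤ FFun α d (xOne α d) ∧
    FFun α d (xOne α d) ≤ Real.exp (1/2) *
      ((Real.exp α * (2 * Real.exp α + 1) / 2) * d / (1 + d)) * (- Real.log (xOne α d)) := by
  set x := xOne α d with hx
  have hx0 : 0 < x := (aux_fb hα hd le_rfl).1
  have hG : ContinuousOn (fun y => GFun α d y) (Icc x 1) := by
    unfold GFun
    have := intervalIntegral.continuousOn_primitive_interval_left (a := x) (b := 1)
      (f := fun y => (1 - fBound α d y) / y) (μ := MeasureTheory.volume) (by
        rw [uIcc_of_le hx1]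
        exact (aux_gcont α d x hd hα le_rfl).integrableOn_Icc)
    rwa [uIcc_of_le hx1] at this
  have hint : IntervalIntegrable (fun y => fBound α d y / y * Real.exp (-(GFun α d y)))
      MeasureTheory.volume x 1 := by
    apply ContinuousOn.intervalIntegrable
    rw [uIcc_of_le hx1]
    refine ((aux_fcont α d x hd hα le_rfl).div continuousOn_id
      (fun y hy => (lt_of_lt_of_le hx0 hy.1).ne')).mul (Real.continuous_exp.comp_continuousOn hG.neg)
  have hk : ∀ k : ℝ, (∫ y in x..1, k * y⁻¹) = k * (- Real.log x) ∧
      IntervalIntegrable (fun y => k * y⁻¹) MeasureTheory.volume x 1 := by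
    intro k
    constructor
    · rw [intervalIntegral.integral_const_mul, integral_inv_of_pos hx0 one_pos]
      simp
    · apply ContinuousOn.intervalIntegrable
      rw [uIcc_of_le hx1]
      exact continuousOn_const.mul
        (continuousOn_id.inv₀ (fun y hy => (lt_of_lt_of_le hx0 hy.1).ne'))
  constructor
  · have h := intervalIntegral.integral_mono_on hx1 (hk (d / (1 + d))).2 hint (fun y hy => by
      obtain ⟨h0, hb1, hb2⟩ := aux_fb hα hd (show xOne α d ≤ y from hy.1)
      have hg := aux_G hα hd (show xOne α d ≤ y from hy.1) hy.2
      have hp : 0 ≤ fBound α d y := le_trans (by positivity) hb1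
      calc d / (1 + d) * y⁻¹ = d / (1 + d) / y := by ring
        _ ≤ fBound α d y := hb1
        _ = fBound α d y / y * y := by field_simp
        _ ≤ _ := mul_le_mul_of_nonneg_left hg.1 (by positivity))
    rw [(hk _).1] at h
    exact h
  · have h := intervalIntegral.integral_mono_on hx1 hint (hk (Real.exp (1/2) *
      ((Real.exp α * (2 * Real.exp α + 1) / 2) * d / (1 + d)))).2 (fun y hy => by
      obtain ⟨h0, hb1, hb2⟩ := aux_fb hα hd (show xOne α d ≤ y from hy.1)
      have hg := aux_G hα hd (show xOne α d ≤ y from hy.1) hy.2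
      have hp : 0 ≤ fBound α d y := le_trans (by positivity) hb1
      calc _ ≤ fBound α d y / y * (Real.exp (1/2) * y) :=
            mul_le_mul_of_nonneg_left hg.2 (by positivity)
        _ = Real.exp (1/2) * fBound α d y := by field_simp
        _ ≤ Real.exp (1/2) * _ := mul_le_mul_of_nonneg_left hb2 (by positivity)
        _ = _ := by ring)
    rw [(hk _).1] at h
    exact h

theorem stmt16 (α : ℝ) (hα : 0 ≤ α) :
    ∃ c₁ C₁ δ₁ : ℝ, 0 < c₁ ∧ 0 < C₁ ∧ 0 < δ₁ ∧
      ∀ δ₀ : ℝ, 0 < δ₀ → δ₀ < δ₁ → 0 < 1 + δ₀ - Real.exp α * δ₀ →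
        c₁ * (δ₀ * Real.log (1 / δ₀)) ≤ FFun α δ₀ (xOne α δ₀) ∧
          FFun α δ₀ (xOne α δ₀) ≤ C₁ * (δ₀ * Real.log (1 / δ₀)) := by
  have ha := Real.one_le_exp hα
  obtain ⟨M, hM⟩ : ∃ M, M = (2 * Real.exp α + 1) * Real.exp α := ⟨_, rfl⟩
  have hM3 : 3 ≤ M := by rw [hM]; nlinarith
  refine ⟨1/4, Real.exp (1/2) * (Real.exp α * (2 * Real.exp α + 1) / 2), 1 / M ^ 2,
    by norm_num, by positivity, by positivity, ?_⟩
  intro d hd hd1 _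
  have hMd : M ^ 2 * d < 1 := by
    rw [lt_div_iff₀ (by positivity)] at hd1; linarith
  have hdd : d < 1 := by nlinarith
  have hxe : xOne α d = M * d / (1 + d) := by unfold xOne; rw [hM]
  have hx0 : 0 < xOne α d := (aux_fb hα hd le_rfl).1
  have hxM : xOne α d ≤ M * d := by
    rw [hxe]; exact div_le_self (by positivity) (by linarith)
  have hdx : d ≤ xOne α d := by
    rw [hxe, le_div_iff₀ (by linarith)]; nlinarith
  have hMd1 : M * d ≤ 1 := by nlinarith
  have hx2 : xOne α d ^ 2 ≤ d := by
    calc xOne α d ^ 2 ≤ (M * d) ^ 2 := by gcongr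
      _ = (M ^ 2 * d) * d := by ring
      _ ≤ 1 * d := by gcongr
      _ = d := one_mul d
  have hl1 : Real.log d ≤ Real.log (xOne α d) := Real.log_le_log hd hdx
  have hl2 : 2 * Real.log (xOne α d) ≤ Real.log d := by
    have := Real.log_le_log (by positivity) hx2
    rw [Real.log_pow] at this
    exact_mod_cast this
  have hl0 : Real.log d ≤ 0 := Real.log_nonpos hd.le hdd.le
  have hlog : Real.log (1 / d) = - Real.log d := by simp
  obtain ⟨h1, h2⟩ := aux_F hα hd (hxM.trans hMd1)
  rw [hlog]
  constructor
  · refine le_trans ?_ h1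
    have e1 : d / 2 ≤ d / (1 + d) := by gcongr; linarith
    calc 1 / 4 * (d * -Real.log d) = d / 2 * (-Real.log d / 2) := by ring
      _ ≤ d / (1 + d) * (-Real.log (xOne α d)) :=
        mul_le_mul e1 (by linarith) (by linarith) (by positivity)
  · refine le_trans h2 ?_
    rw [← mul_assoc]
    apply mul_le_mul _ (by linarith) (by linarith) (by positivity)
    rw [mul_assoc (Real.exp (1/2))]
    apply mul_le_mul_of_nonneg_left _ (by positivity)
    exact div_le_self (by positivity) (by linarith)
end

section
/- Fix α ≥ 0. For δ₀ > 0 with 1 + δ₀ − e^{α}δ₀ > 0 set x₀ := e^{α}δ₀/(1+δ₀), f(y) := e^{2α}δ₀/( y(δ₀+1) − e^{α}δ₀ ) for y ∈ (x₀,1], G(x) := ∫_x^1 (1 − f(y))/y dy, F(x) := ∫_x^1 (f(y)/y) e^{−G(y)} dy, x₁ = x₁(δ₀) := (2e^{α}+1)e^{α}δ₀/(1+δ₀), and E(δ₀) := F(x₁(δ₀)) + e^{−G(x₁(δ₀))}. Then there exist constants c₁ > 0, C₁ > 0 and δ₁ > 0 such that for all 0 < δ₀ < δ₁: c₁ δ₀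 log(1/δ₀) ≤ E(δ₀) ≤ C₁ δ₀ log(1/δ₀). -/
open Set

/-- The threshold `E(δ₀) = F(x₁(δ₀)) + e^{-G(x₁(δ₀))}`. -/
noncomputable def EFun (α δ₀ : ℝ) : ℝ :=
  FFun α δ₀ (xOne α δ₀) + Real.exp (-(GFun α δ₀ (xOne α δ₀)))

theorem aux_G_s17 (f : ℝ → ℝ) (x p : ℝ) (hx : 0 < x) (hp : 0 < p)
    (hf : ContinuousOn f (Icc x 1)) (hl : ∀ y ∈ Icc x 1, p / y ≤ f y)
    (hu : ∀ y ∈ Icc x 1, f y ≤ x / (2 * y)) (z : ℝ) (hz : z ∈ Icc x 1) :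
    z ≤ Real.exp (-(∫ y in z..1, (1 - f y) / y)) ∧
    Real.exp (-(∫ y in z..1, (1 - f y) / y)) ≤ 2 * z := by
  obtain ⟨h1, h2⟩ := hz
  have hz0 : 0 < z := by linarith
  have hsub : Icc z 1 ⊆ Icc x 1 := Icc_subset_Icc_left h1
  have hne : ∀ y ∈ Icc z 1, y ≠ 0 := fun y hy => by have := hy.1; intro h; linarith
  have hc1 : ContinuousOn (fun y => (1 - f y) / y) (Icc z 1) :=
    (continuousOn_const.sub (hf.mono hsub)).div continuousOn_id hne
  have hc2 : ContinuousOn (fun y : ℝ => 1 / y) (Icc z 1) :=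
    continuousOn_const.div continuousOn_id hne
  have hc3 : ContinuousOn (fun y : ℝ => 1 / y - x / 2 * (1 / y ^ 2)) (Icc z 1) :=
    hc2.sub (continuousOn_const.mul (continuousOn_const.div (continuousOn_id.pow 2)
      (fun y hy => pow_ne_zero 2 (hne y hy))))
  have hi1 := hc1.intervalIntegrable_of_Icc (μ := MeasureTheory.volume) h2
  have hi2 := hc2.intervalIntegrable_of_Icc (μ := MeasureTheory.volume) h2
  have hi3 := hc3.intervalIntegrable_of_Icc (μ := MeasureTheory.volume) h2
  have e2 : ∫ y in z..1, 1 / y = - Real.log z := by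
    rw [integral_one_div_of_pos hz0 one_pos]; simp
  have e3 : ∫ y in z..1, (1 / y - x / 2 * (1 / y ^ 2)) = - Real.log z - x / 2 * (1 / z - 1) := by
    rw [intervalIntegral.integral_eq_sub_of_hasDerivAt
      (f := fun y => Real.log y + x / 2 * (1 / y)) _ hi3]
    · simp; ring
    · intro y hy
      rw [uIcc_of_le h2] at hy
      have hy0 := hne y hy
      have := (Real.hasDerivAt_log hy0).add ((hasDerivAt_inv hy0).const_mul (x / 2))
      convert this using 1
      · ext; simp
      · field_simp
        ring
  have m1 : ∫ y in z..1, (1 - f y) / y ≤ ∫ y in z..1, 1 / y := by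
    apply intervalIntegral.integral_mono_on h2 hi1 hi2
    intro y hy
    have hy0 : 0 < y := by have := hy.1; linarith
    have := hl y (hsub hy)
    have : 0 < p / y := by positivity
    gcongr
    linarith
  have m2 : ∫ y in z..1, (1 / y - x / 2 * (1 / y ^ 2)) ≤ ∫ y in z..1, (1 - f y) / y := by
    apply intervalIntegral.integral_mono_on h2 hi3 hi1
    intro y hy
    have hy0 : 0 < y := by have := hy.1; linarith
    have h := hu y (hsub hy)
    have : 1 / y - x / 2 * (1 / y ^ 2) = (1 - x / (2 * y)) / y := by field_simp
    rw [this]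
    gcongr
  rw [e2] at m1
  rw [e3] at m2
  constructor
  · calc z = Real.exp (Real.log z) := (Real.exp_log hz0).symm
      _ ≤ _ := Real.exp_le_exp.2 (by linarith)
  · have hxz : x * (1 / z) ≤ 1 := by rw [mul_one_div, div_le_one hz0]; exact h1
    have hlog : (1:ℝ) / 2 ≤ Real.log 2 := by have := Real.log_two_gt_d9; linarith
    calc _ ≤ Real.exp (Real.log (2 * z)) := by
          apply Real.exp_le_exp.2
          rw [Real.log_mul (by norm_num) hz0.ne']
          nlinarith
      _ = 2 * z := Real.exp_log (by positivity)

theorem aux_F_s17 (f : ℝ → ℝ) (x p : ℝ) (hx : 0 < x) (hx1 : x ≤ 1) (hp : 0 < p)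
    (hf : ContinuousOn f (Icc x 1)) (hl : ∀ y ∈ Icc x 1, p / y ≤ f y)
    (hu : ∀ y ∈ Icc x 1, f y ≤ x / (2 * y)) :
    p * (-Real.log x) ≤ ∫ z in x..1, f z / z * Real.exp (-(∫ y in z..1, (1 - f y) / y)) ∧
    ∫ z in x..1, f z / z * Real.exp (-(∫ y in z..1, (1 - f y) / y)) ≤ x * (-Real.log x) := by
  have hne : ∀ y ∈ Icc x 1, y ≠ 0 := fun y hy => by have := hy.1; intro h; linarith
  have hc1 : ContinuousOn (fun y => (1 - f y) / y) (Icc x 1) :=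
    (continuousOn_const.sub hf).div continuousOn_id hne
  have hG : ContinuousOn (fun z => ∫ y in z..1, (1 - f y) / y) (Icc x 1) := by
    have := intervalIntegral.continuousOn_primitive_interval_left
      (f := fun y => (1 - f y) / y) (a := x) (b := 1) (μ := MeasureTheory.volume)
      (by rw [uIcc_of_le hx1]; exact hc1.integrableOn_Icc)
    rwa [uIcc_of_le hx1] at this
  have hc : ContinuousOn (fun z => f z / z * Real.exp (-(∫ y in z..1, (1 - f y) / y))) (Icc x 1) :=
    (hf.div continuousOn_id hne).mul (Real.continuous_exp.comp_continuousOn hG.neg)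
  have hc2 : ∀ c : ℝ, ContinuousOn (fun y : ℝ => c * (1 / y)) (Icc x 1) := fun c =>
    continuousOn_const.mul (continuousOn_const.div continuousOn_id hne)
  have hi := hc.intervalIntegrable_of_Icc (μ := MeasureTheory.volume) hx1
  have hi2 := fun c => (hc2 c).intervalIntegrable_of_Icc (μ := MeasureTheory.volume) hx1
  have e2 : ∀ c : ℝ, ∫ y in x..1, c * (1 / y) = c * (- Real.log x) := fun c => by
    rw [intervalIntegral.integral_const_mul, integral_one_div_of_pos hx one_pos]; simp
  rw [← e2, ← e2]
  constructor
  · apply intervalIntegral.integral_mono_on hx1 (hi2 _) hi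
    intro y hy
    have hy0 : 0 < y := by have := hy.1; linarith
    obtain ⟨g1, g2⟩ := aux_G_s17 f x p hx hp hf hl hu y hy
    have h := hl y hy
    calc p * (1 / y) = (p / y) / y * y := by field_simp
      _ ≤ _ := by
        have : 0 < p / y := by positivity
        have : 0 < f y := by linarith
        gcongr
  · apply intervalIntegral.integral_mono_on hx1 hi (hi2 _)
    intro y hy
    have hy0 : 0 < y := by have := hy.1; linarith
    obtain ⟨g1, g2⟩ := aux_G_s17 f x p hx hp hf hl hu y hy
    have h := hu y hy
    calc _ ≤ (x / (2 * y)) / y * (2 * y) := by gcongr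
      _ = x * (1 / y) := by field_simp

theorem stmt17 (α : ℝ) (hα : 0 ≤ α) :
    ∃ c₁ C₁ δ₁ : ℝ, 0 < c₁ ∧ 0 < C₁ ∧ 0 < δ₁ ∧
      ∀ δ₀ : ℝ, 0 < δ₀ → δ₀ < δ₁ → 0 < 1 + δ₀ - Real.exp α * δ₀ →
        c₁ * (δ₀ * Real.log (1 / δ₀)) ≤ EFun α δ₀ ∧
          EFun α δ₀ ≤ C₁ * (δ₀ * Real.log (1 / δ₀)) := by
  obtain ⟨a, ha⟩ : ∃ a, a = Real.exp α := ⟨_, rfl⟩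
  have ha1 : 1 ≤ a := by rw [ha]; exact Real.one_le_exp hα
  have ha2 : Real.exp (2 * α) = a ^ 2 := by rw [ha, ← Real.exp_nat_mul]; simp
  obtain ⟨K, hK⟩ : ∃ K, K = (2 * a + 1) * a := ⟨_, rfl⟩
  have hK3 : 3 ≤ K := by rw [hK]; nlinarith
  refine ⟨1 / 4, 3 * K, 1 / K ^ 2, by norm_num, by positivity, by positivity, ?_⟩
  intro δ hδ hδ1 _
  have hKδ : K ^ 2 * δ < 1 := by
    rw [lt_div_iff₀ (by positivity)] at hδ1; linarith
  have hδ9 : δ < 1 / 9 := by nlinarith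
  obtain ⟨x, hxdef⟩ : ∃ x, x = K * δ / (1 + δ) := ⟨_, rfl⟩
  have hX : xOne α δ = x := by rw [xOne, ← ha, ← hK, hxdef]
  have hx0 : 0 < x := by rw [hxdef]; positivity
  have hxm : x * (1 + δ) = K * δ := by rw [hxdef]; field_simp
  have hxK : x ≤ K * δ := by nlinarith
  have hxδ : δ ≤ x := by
    rw [hxdef, le_div_iff₀ (by positivity)]; nlinarith
  have hx1 : x ≤ 1 := by nlinarith
  have hden : ∀ y ∈ Icc x 1, 2 * a * (a * δ) ≤ y * (δ + 1) - a * δ := by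
    intro y hy
    have : x * (1 + δ) ≤ y * (1 + δ) := by gcongr; exact hy.1
    rw [hxm, hK] at this
    nlinarith
  have hpos : 0 < 2 * a * (a * δ) := by positivity
  have hfeq : ∀ y, fBound α δ y = a ^ 2 * δ / (y * (δ + 1) - a * δ) := by
    intro y; rw [fBound, ha2, ← ha]
  have hf : ContinuousOn (fBound α δ) (Icc x 1) := by
    have : fBound α δ = fun y => a ^ 2 * δ / (y * (δ + 1) - a * δ) := funext hfeq
    rw [this]
    apply ContinuousOn.div (by fun_prop) (by fun_prop)
    intro y hy
    have := hden y hy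
    intro h; linarith
  have hp : 0 < a ^ 2 * δ / (1 + δ) := by positivity
  have hl : ∀ y ∈ Icc x 1, a ^ 2 * δ / (1 + δ) / y ≤ fBound α δ y := by
    intro y hy
    have hy0 : 0 < y := by have := hy.1; linarith
    have := hden y hy
    rw [hfeq, div_div]
    apply div_le_div_of_nonneg_left (by positivity) (by linarith)
    have : 0 < a * δ := by positivity
    linarith
  have hu : ∀ y ∈ Icc x 1, fBound α δ y ≤ x / (2 * y) := by
    intro y hy
    have hy0 : 0 < y := by have := hy.1; linarith
    have h := hden y hy
    have hd : 0 < y * (δ + 1) - a * δ := by linarith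
    have h3 : x * (1 + δ) ≤ y * (1 + δ) := by gcongr; exact hy.1
    rw [hxm] at h3
    rw [hfeq, hxdef, div_div, div_le_div_iff₀ hd (by positivity)]
    have : a ^ 2 * δ * ((1 + δ) * (2 * y)) + a * δ * (y * (1 + δ) - K * δ)
        = K * δ * (y * (δ + 1) - a * δ) := by rw [hK]; ring
    have : 0 ≤ a * δ * (y * (1 + δ) - K * δ) := by
      apply mul_nonneg (by positivity); linarith
    linarith
  obtain ⟨g1, g2⟩ := aux_G_s17 (fBound α δ) x _ hx0 hp hf hl hu x ⟨le_rfl, hx1⟩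
  obtain ⟨f1, f2⟩ := aux_F_s17 (fBound α δ) x _ hx0 hx1 hp hf hl hu
  have hE : EFun α δ = (∫ z in x..1, fBound α δ z / z *
      Real.exp (-(∫ y in z..1, (1 - fBound α δ y) / y))) +
      Real.exp (-(∫ y in x..1, (1 - fBound α δ y) / y)) := by
    rw [EFun, hX]; rfl
  rw [hE, one_div δ, Real.log_inv]
  have l1 : Real.log δ ≤ Real.log x := Real.log_le_log hδ hxδ
  have l2 : Real.log x ≤ Real.log K + Real.log δ := by
    rw [← Real.log_mul (by positivity) hδ.ne']
    exact Real.log_le_log hx0 hxK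
  have l3 : 2 * Real.log K + Real.log δ ≤ 0 := by
    have := Real.log_nonpos (by positivity) hKδ.le
    rw [Real.log_mul (by positivity) hδ.ne', Real.log_pow] at this
    exact_mod_cast this
  have l4 : 1 ≤ Real.log K := by
    rw [Real.le_log_iff_exp_le (by positivity)]
    have := Real.exp_one_lt_d9
    linarith
  constructor
  · have q1 : δ / 2 ≤ a ^ 2 * δ / (1 + δ) := by
      rw [div_le_div_iff₀ (by norm_num) (by positivity)]
      have : 1 * δ ≤ a ^ 2 * δ := by gcongr; nlinarith
      nlinarith
    have q2 : δ / 2 * (-Real.log δ / 2) ≤ a ^ 2 * δ / (1 + δ) * (-Real.log x) := by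
      apply mul_le_mul q1 (by linarith) (by linarith) hp.le
    linarith
  · have q : x * (-Real.log x + 2) ≤ K * δ * (3 * (-Real.log δ)) := by
      apply mul_le_mul hxK (by linarith) (by linarith) (by positivity)
    linarith
end

section
/- Let Ω > 0, r ≥ 0, φ be smooth real functions on a neighborhood of the segment {u}×[v*,V] in the (u,v)-plane satisfying the Raychaudhuri equation ∂_v(Ω⁻² ∂_v r) = −r Ω⁻² (∂_v φ)² on this segment. If ∂_v r(u,v*) ≤ 0, then ∂_v r(u,v) ≤ 0 for all v ∈ [v*,V]. -/
open Set

theorem stmt18 (Ω r φ : ℝ × ℝ → ℝ) (u vstar V : ℝ) (hv : vstar ≤ V)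
    (O : Set (ℝ × ℝ)) (hO : IsOpen O) (hSO : ({u} : Set ℝ) ×ˢ Icc vstar V ⊆ O)
    (hΩreg : ContDiffOn ℝ (⊤ : ℕ∞) Ω O) (hrreg : ContDiffOn ℝ (⊤ : ℕ∞) r O)
    (hφreg : ContDiffOn ℝ (⊤ : ℕ∞) φ O)
    (hΩpos : ∀ q ∈ O, 0 < Ω q) (hrnonneg : ∀ q ∈ O, 0 ≤ r q)
    (hray : ∀ p ∈ ({u} : Set ℝ) ×ˢ Icc vstar V,
      pdv (fun q => ((Ω q) ^ 2)⁻¹ * pdv r q) p = -(r p) * ((Ω p) ^ 2)⁻¹ * (pdv φ p) ^ 2)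
    (h0 : pdv r (u, vstar) ≤ 0) :
    ∀ v ∈ Icc vstar V, pdv r (u, v) ≤ 0 := by
  intro v hvm
  have hc : ContDiff ℝ (⊤ : ℕ∞) (fun t : ℝ => ((u, t) : ℝ × ℝ)) := by fun_prop
  set W : Set ℝ := (fun t : ℝ => ((u, t) : ℝ × ℝ)) ⁻¹' O with hW
  have hWo : IsOpen W := hO.preimage hc.continuous
  have hIW : Icc vstar V ⊆ W := fun t ht => hSO ⟨rfl, ht⟩
  have hR : ContDiffOn ℝ (⊤ : ℕ∞) (fun t => r (u, t)) W :=
    hrreg.comp hc.contDiffOn (fun t ht => ht)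
  have hM : ContDiffOn ℝ (⊤ : ℕ∞) (fun t => Ω (u, t)) W :=
    hΩreg.comp hc.contDiffOn (fun t ht => ht)
  have hR' : ContDiffOn ℝ 1 (deriv (fun t => r (u, t))) W :=
    hR.deriv_of_isOpen hWo (WithTop.coe_le_coe.2 (le_top : (1 + 1 : ℕ∞) ≤ ⊤))
  have hG : DifferentiableOn ℝ (fun t => ((Ω (u, t)) ^ 2)⁻¹ * deriv (fun t => r (u, t)) t) W := by
    refine DifferentiableOn.mul (DifferentiableOn.inv ((hM.differentiableOn (by simp)).pow 2) ?_)
      (hR'.differentiableOn (by simp))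
    intro t ht
    exact (pow_pos (hΩpos _ ht) 2).ne'
  have hanti : AntitoneOn (fun t => ((Ω (u, t)) ^ 2)⁻¹ * deriv (fun t => r (u, t)) t)
      (Icc vstar V) := by
    refine antitoneOn_of_deriv_nonpos (convex_Icc _ _) (hG.continuousOn.mono hIW)
      (hG.mono (interior_subset.trans hIW)) ?_
    intro t ht
    have ht := interior_subset ht
    have h := hray (u, t) ⟨rfl, ht⟩
    simp only [pdv] at h
    rw [h]
    have h1 := hrnonneg _ (hIW ht)
    have h2 := hΩpos _ (hIW ht)
    have : 0 ≤ r (u, t) * ((Ω (u, t)) ^ 2)⁻¹ * (deriv (fun s => φ (u, s)) t) ^ 2 := by positivity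
    linarith
  have h3 := hanti (left_mem_Icc.2 hv) hvm hvm.1
  have h4 := hΩpos _ (hIW hvm)
  have h5 := hΩpos _ (hIW (left_mem_Icc.2 hv))
  simp only [pdv] at h0 ⊢
  by_contra! hcon
  have h6 : 0 < ((Ω (u, v)) ^ 2)⁻¹ * deriv (fun t => r (u, t)) v := by positivity
  have h7 : ((Ω (u, vstar)) ^ 2)⁻¹ * deriv (fun t => r (u, t)) vstar ≤ 0 :=
    mul_nonpos_of_nonneg_of_nonpos (by positivity) h0
  simp only at h3
  linarith
end
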